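/- Let X be a Banach lattice with a directed bounded generating system Π such that σ(X) ∈ 𝔉_X^{⋆,μ} for every σ ∈ Π, for some μ ≥ 1; for each σ ∈ Π let (x_i^{(σ)}) be a shrinking basis for σ(X) satisfying (⋆) with constant μ in each summand and let (e_n^{(σ)}) be the corresponding partial-sum projections, regarded as elements ι_σ e_n^{(σ)} p_σ of ℒʳ(X). Suppose in addition that lim_σ ‖λ − λ∘σ‖ = 0 for every λ ∈ X′. Let 𝔛 be a Banach lattice 𝒜ʳ(X)-module in which the sequences (e_n^{(σ)}·x) and (x·e_n^{(σ)}) converge in norm for every x ∈ 𝔛 and σ ∈ Π. If either (i) X contains no subspace isomorphic to ℓ₁ and 𝔛 contains no complemented subspace isomorphic to ℓ₁, or (ii) X is reflexive and dim(e_n^{(σ)}·𝔛′·e_n^{(σ)}) < ∞ for all n ∈ ℕ and σ ∈ Π, then every bounded derivation D : 𝒜ʳ(X) → 𝔛′ is regular. -/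

import Mathlib

/- STATEMENT 10 (final Corollary, non-atomic case): regularity of every bounded
   derivation from 𝒜ʳ(X) into the dual of a Banach lattice 𝒜ʳ(X)-module in which the
   sequences (e_n^{(σ)}·x) and (x·e_n^{(σ)}) converge in norm, for X with a directed
   bounded generating system whose ranges lie in F_X^{star,mu}, under (i) or (ii). -/

open Filter Topology

section Prelude

variable {X 𝔛 : Type*} [NormedAddCommGroup X] [Lattice X] [HasSolidNorm X] [IsOrderedAddMonoid X] [NormedSpace ℝ X]
variable [NormedAddCommGroup 𝔛] [Lattice 𝔛] [HasSolidNorm 𝔛] [IsOrderedAddMonoid 𝔛] [NormedSpace ℝ 𝔛]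

/-- A bounded operator is positive if it maps the positive cone into itself. -/
def IsPosOp (T : X →L[ℝ] X) : Prop := ∀ x : X, 0 ≤ x → 0 ≤ T x

/-- The operator order on regular operators. -/
def opLe (S T : X →L[ℝ] X) : Prop := IsPosOp (T - S)

/-- ℒʳ(X): the regular operators, i.e. linear combinations of positive operators. -/
def LrSet (X : Type*) [NormedAddCommGroup X] [Lattice X] [HasSolidNorm X] [IsOrderedAddMonoid X] [NormedSpace ℝ X] :
    Set (X →L[ℝ] X) :=
  {T | ∃ (n : ℕ) (c : Fin n → ℝ) (S : Fin n → X →L[ℝ] X),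
    (∀ i, IsPosOp (S i)) ∧ T = ∑ i, c i • S i}

/-- The regular norm ‖T‖ᵣ = inf{‖S‖ : |Tx| ≤ S|x| for all x}. -/
noncomputable def rnorm (T : X →L[ℝ] X) : ℝ :=
  sInf {c : ℝ | ∃ S : X →L[ℝ] X, ‖S‖ = c ∧ ∀ x : X, |T x| ≤ S |x|}

/-- ℱ(X): continuous finite-rank operators. -/
def FinRankOp (T : X →L[ℝ] X) : Prop :=
  ∃ (n : ℕ) (f : Fin n → X →L[ℝ] ℝ) (v : Fin n → X), T = ∑ i, (f i).smulRight (v i)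

/-- 𝒜ʳ(X): the ‖·‖ᵣ-closure of ℱ(X) in ℒʳ(X). -/
def ArSet (X : Type*) [NormedAddCommGroup X] [Lattice X] [HasSolidNorm X] [IsOrderedAddMonoid X] [NormedSpace ℝ X] :
    Set (X →L[ℝ] X) :=
  {T | T ∈ LrSet X ∧ ∀ ε : ℝ, 0 < ε → ∃ F : X →L[ℝ] X, FinRankOp F ∧ rnorm (T - F) < ε}

/-- x is a normalized atom of the Banach lattice X. -/
def IsNormAtom (a : X) : Prop :=
  0 < a ∧ ‖a‖ = 1 ∧ ∀ y : X, 0 ≤ y → y ≤ a → ∃ c : ℝ, y = c • a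

/-- The dual (pointwise-on-the-cone) order on 𝔛′ = 𝔛 →L[ℝ] ℝ. -/
def dualLe (f g : 𝔛 →L[ℝ] ℝ) : Prop := ∀ y : 𝔛, 0 ≤ y → f y ≤ g y

/-- Least upper bound with respect to the dual order. -/
def dualIsLUB (S : Set (𝔛 →L[ℝ] ℝ)) (f : 𝔛 →L[ℝ] ℝ) : Prop :=
  (∀ g ∈ S, dualLe g f) ∧ ∀ h : 𝔛 →L[ℝ] ℝ, (∀ g ∈ S, dualLe g h) → dualLe f h

/-- A subset of the dual is weak*-closed. -/
def wstarClosed (S : Set (𝔛 →L[ℝ] ℝ)) : Prop :=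
  IsClosed (StrongDual.toWeakDual '' S)

/-- (y i)_{i<n} and (z i)_{i<n} are L-equivalent. -/
def seqEquivUpTo (L : ℝ) (n : ℕ) (y z : ℕ → X) : Prop :=
  ∀ α : ℕ → ℝ,
    ‖∑ i ∈ Finset.range n, α i • y i‖ ≤ L * ‖∑ i ∈ Finset.range n, α i • z i‖ ∧
    ‖∑ i ∈ Finset.range n, α i • z i‖ ≤ L * ‖∑ i ∈ Finset.range n, α i • y i‖

/-- The sequence (x i) satisfies the selection property (⋆) with constant μ. -/
def StarSeq (μ : ℝ) (x : ℕ → X) : Prop :=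
  ∃ μs : ℕ → ℝ, (∀ n, 1 ≤ μs n ∧ μs n ≤ μ) ∧
    ∀ (n : ℕ) (l : ℕ → ℕ), 0 < n → (∀ i j, i < j → j < n → l i < l j) →
      seqEquivUpTo (μs n) n x (fun i => x (l i)) →
      ∀ k : ℕ, ∃ m : ℕ, l (n - 1) + k ≤ m ∧
        seqEquivUpTo (μs (n + 1)) (n + 1) x (fun i => x (Function.update l n m i))

/-- (x i) is (an enumeration of the normalized atoms of X forming) a basis for
X = (⊕_n X_n)_𝐞 satisfying (⋆) with constant μ in each summand: there is a partition
of ℕ into slices (ψ n ·), n ∈ I, order preserving on each slice, such that on each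
slice the (⋆)-property holds with constant μ, the slices are pairwise disjoint
sublattices, and the decomposition into slices is 1-unconditional. -/
def StarSummandBasis (μ : ℝ) (x : ℕ → X) : Prop :=
  ∃ (I : Set ℕ) (ψ : ℕ → ℕ → ℕ),
    (∀ n ∈ I, StrictMono (ψ n)) ∧
    (∀ i : ℕ, ∃! p : ℕ × ℕ, p.1 ∈ I ∧ ψ p.1 p.2 = i) ∧
    (∀ n ∈ I, StarSeq μ (fun j => x (ψ n j))) ∧
    (∀ i, IsNormAtom (x i)) ∧
    (∀ a : X, IsNormAtom a → ∃ i, x i = a) ∧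
    (∀ n ∈ I, ∀ m ∈ I, n ≠ m → ∀ j j' : ℕ, x (ψ n j) ⊓ x (ψ m j') = 0) ∧
    (∀ (s : Finset ℕ) (α ε : ℕ → ℝ),
      (∀ n ∈ I, ∀ j j' : ℕ, ε (ψ n j) = ε (ψ n j')) → (∀ i, |ε i| ≤ 1) →
      ‖∑ i ∈ s, (ε i * α i) • x i‖ ≤ ‖∑ i ∈ s, α i • x i‖)

/-- A sequence in the dual is equivalent to the unit vector basis of c₀. -/
def EquivC0Basis (ξ : ℕ → (𝔛 →L[ℝ] ℝ)) : Prop :=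
  ∃ L : ℝ, 0 < L ∧ ∀ (m : ℕ) (α : ℕ → ℝ),
    (∀ j < m, |α j| ≤ L * ‖∑ i ∈ Finset.range m, α i • ξ i‖) ∧
    (∀ B : ℝ, 0 ≤ B → (∀ i < m, |α i| ≤ B) →
      ‖∑ i ∈ Finset.range m, α i • ξ i‖ ≤ L * B)

/-- A map D defined (at least) on A ⊆ ℒʳ(X), with values in 𝔛′, is regular if on A it
is a finite linear combination of positive linear maps. -/
def RegularDerivOn (A : Set (X →L[ℝ] X)) (D : (X →L[ℝ] X) → (𝔛 →L[ℝ] ℝ)) : Prop :=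
  ∃ (n : ℕ) (c : Fin n → ℝ) (P : Fin n → (X →L[ℝ] X) → (𝔛 →L[ℝ] ℝ)),
    (∀ t, (∀ a ∈ A, ∀ b ∈ A, P t (a + b) = P t a + P t b) ∧
          (∀ (r : ℝ), ∀ a ∈ A, P t (r • a) = r • P t a) ∧
          (∀ a ∈ A, IsPosOp a → dualLe 0 (P t a))) ∧
    ∀ a ∈ A, D a = ∑ t, c t • P t a

/-- 𝔛 contains a complemented subspace isomorphic to ℓ₁. -/
def HasComplementedL1 (𝔛 : Type*) [NormedAddCommGroup 𝔛] [Lattice 𝔛] [HasSolidNorm 𝔛] [IsOrderedAddMonoid 𝔛] [NormedSpace ℝ 𝔛] :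
    Prop :=
  ∃ (P : 𝔛 →L[ℝ] 𝔛) (e : ℕ → 𝔛) (L : ℝ), 0 < L ∧ P ∘L P = P ∧
    (∀ y : 𝔛, P y ∈ closure (Submodule.span ℝ (Set.range e) : Set 𝔛)) ∧
    (∀ i, P (e i) = e i) ∧
    (∀ (m : ℕ) (α : ℕ → ℝ),
      L⁻¹ * ∑ i ∈ Finset.range m, |α i| ≤ ‖∑ i ∈ Finset.range m, α i • e i‖ ∧
      ‖∑ i ∈ Finset.range m, α i • e i‖ ≤ L * ∑ i ∈ Finset.range m, |α i|)

end Prelude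

section Prelude2

variable {X 𝔛 : Type*} [NormedAddCommGroup X] [Lattice X] [HasSolidNorm X] [IsOrderedAddMonoid X] [NormedSpace ℝ X]
variable [NormedAddCommGroup 𝔛] [Lattice 𝔛] [HasSolidNorm 𝔛] [IsOrderedAddMonoid 𝔛] [NormedSpace ℝ 𝔛]

/-- a is a normalized atom of the sublattice V of X. -/
def IsNormAtomOn (V : Set X) (a : X) : Prop :=
  a ∈ V ∧ 0 < a ∧ ‖a‖ = 1 ∧ ∀ y ∈ V, 0 ≤ y → y ≤ a → ∃ c : ℝ, y = c • a

/-- (x i) is a basis of the sublattice V of X satisfying (⋆) with constant μ in each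
summand of a 1-unconditional decomposition of V (this encodes V ∈ 𝔉_X^{⋆,μ} together
with the choice of such a basis). -/
def StarSummandBasisOn (V : Set X) (μ : ℝ) (x : ℕ → X) : Prop :=
  ∃ (I : Set ℕ) (ψ : ℕ → ℕ → ℕ),
    (∀ n ∈ I, StrictMono (ψ n)) ∧
    (∀ i : ℕ, ∃! p : ℕ × ℕ, p.1 ∈ I ∧ ψ p.1 p.2 = i) ∧
    (∀ n ∈ I, StarSeq μ (fun j => x (ψ n j))) ∧
    (∀ i, IsNormAtomOn V (x i)) ∧
    (∀ a : X, IsNormAtomOn V a → ∃ i, x i = a) ∧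
    (∀ n ∈ I, ∀ m ∈ I, n ≠ m → ∀ j j' : ℕ, x (ψ n j) ⊓ x (ψ m j') = 0) ∧
    (∀ (s : Finset ℕ) (α ε : ℕ → ℝ),
      (∀ n ∈ I, ∀ j j' : ℕ, ε (ψ n j) = ε (ψ n j')) → (∀ i, |ε i| ≤ 1) →
      ‖∑ i ∈ s, (ε i * α i) • x i‖ ≤ ‖∑ i ∈ s, α i • x i‖)

/-- The partial-sum (natural) projections of a basis, as operators on X. -/
noncomputable def eproj (xb : ℕ → X) (xsb : ℕ → X →L[ℝ] ℝ) (n : ℕ) : X →L[ℝ] X :=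
  ∑ i ∈ Finset.range n, (xsb i).smulRight (xb i)

/-- 𝒜_σ := {a ∈ ℒʳ(σ(X)) : ι_σ a p_σ ∈ 𝒜}, realised inside ℒʳ(X) as the set of
elements b of 𝒜 with σ ∘ b ∘ σ = b. -/
def ASigma (A : Set (X →L[ℝ] X)) (σ : X →L[ℝ] X) : Set (X →L[ℝ] X) :=
  {b | b ∈ A ∧ σ ∘L (b ∘L σ) = b}

/-- The filter of "eventually for all σ large enough" along the directed set Π,
ordered by σ₁ ≼ σ₂ ⟺ σ₁(X) ⊆ σ₂(X). -/
def piFilter (Pi : Set (X →L[ℝ] X)) : Filter {σ : X →L[ℝ] X // σ ∈ Pi} :=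
  ⨅ σ₀ : {σ : X →L[ℝ] X // σ ∈ Pi},
    Filter.principal {σ | Set.range ⇑(σ₀.val) ⊆ Set.range ⇑(σ.val)}

end Prelude2

/-- Y contains a subspace isomorphic to ℓ₁ (witnessed by a sequence equivalent to the
unit vector basis of ℓ₁). -/
def HasL1Copy (Y : Type*) [NormedAddCommGroup Y] [NormedSpace ℝ Y] : Prop :=
  ∃ (e : ℕ → Y) (L : ℝ), 0 < L ∧ ∀ (m : ℕ) (α : ℕ → ℝ),
    L⁻¹ * ∑ i ∈ Finset.range m, |α i| ≤ ‖∑ i ∈ Finset.range m, α i • e i‖ ∧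
    ‖∑ i ∈ Finset.range m, α i • e i‖ ≤ L * ∑ i ∈ Finset.range m, |α i|


set_option linter.unusedSectionVars false

section BanachLattice

variable {E : Type*} [NormedAddCommGroup E] [Lattice E] [HasSolidNorm E] [IsOrderedAddMonoid E]
  [NormedSpace ℝ E]

theorem BanachLattice.smul_nonneg {c : ℝ} {x : E} (hc : 0 ≤ c) (hx : 0 ≤ x) : 0 ≤ c • x := by
  have half : ∀ n : ℕ, (0 : E) ≤ ((2 : ℝ) ^ n)⁻¹ • x := by
    intro n
    induction n with
    | zero => simpa using hx
    | succ n ih =>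
      refine nsmul_two_semiclosed ?_
      have : (2 : ℕ) • ((2 : ℝ) ^ (n + 1))⁻¹ • x = ((2 : ℝ) ^ n)⁻¹ • x := by
        rw [← Nat.cast_smul_eq_nsmul ℝ, smul_smul]
        congr 1
        rw [pow_succ]
        field_simp
        norm_num
      rw [this]
      exact ih
  have hlim : Tendsto (fun n : ℕ => ((⌊c * (2 : ℝ) ^ n⌋₊ : ℝ) / (2 : ℝ) ^ n) • x) atTop
      (𝓝 (c • x)) :=
    ((tendsto_nat_floor_mul_div_atTop hc).comp
      (tendsto_pow_atTop_atTop_of_one_lt one_lt_two)).smul_const x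
  refine ge_of_tendsto' hlim fun n => ?_
  rw [div_eq_mul_inv, mul_smul, Nat.cast_smul_eq_nsmul]
  exact nsmul_nonneg (half n) _

instance BanachLattice.posSMulMono : PosSMulMono ℝ E :=
  PosSMulMono.of_smul_nonneg fun _ hc _ hx => BanachLattice.smul_nonneg hc hx

theorem BanachLattice.abs_smul_le (c : ℝ) (x : E) : |c • x| ≤ |c| • |x| := by
  refine abs_le'.2 ?_
  rcases le_total 0 c with hc | hc
  · rw [abs_of_nonneg hc]
    exact ⟨smul_le_smul_of_nonneg_left (le_abs_self x) hc,
      by rw [← smul_neg]; exact smul_le_smul_of_nonneg_left (neg_le_abs x) hc⟩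
  · rw [abs_of_nonpos hc]
    have hc' : 0 ≤ -c := neg_nonneg.2 hc
    refine ⟨?_, ?_⟩
    · simpa using smul_le_smul_of_nonneg_left (neg_le_abs x) hc'
    · simpa using smul_le_smul_of_nonneg_left (le_abs_self x) hc'

theorem BanachLattice.abs_sum_le {ι : Type*} (s : Finset ι) (f : ι → E) :
    |∑ i ∈ s, f i| ≤ ∑ i ∈ s, |f i| :=
  Finset.le_sum_of_subadditive _ (by simp) (fun _ _ => abs_add_le _ _) _ _

theorem BanachLattice.norm_le_of_abs_le {x y : E} (h : |x| ≤ y) : ‖x‖ ≤ ‖y‖ :=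
  norm_le_norm_of_abs_le_abs (h.trans (le_abs_self y))

theorem BanachLattice.norm_mono {x y : E} (hx : 0 ≤ x) (h : x ≤ y) : ‖x‖ ≤ ‖y‖ :=
  BanachLattice.norm_le_of_abs_le (by rwa [abs_of_nonneg hx])

theorem BanachLattice.abs_map_le {F : Type*} [NormedAddCommGroup F] [Lattice F] [HasSolidNorm F]
    [IsOrderedAddMonoid F] [NormedSpace ℝ F] (T : E →ₗ[ℝ] F) (hT : ∀ x, 0 ≤ x → 0 ≤ T x) (x : E) :
    |T x| ≤ T |x| := by
  refine abs_le'.2 ⟨?_, ?_⟩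
  · have := hT _ (sub_nonneg.2 (le_abs_self x))
    rwa [map_sub, sub_nonneg] at this
  · have := hT _ (sub_nonneg.2 (neg_le_abs x))
    rwa [map_sub, sub_nonneg, map_neg] at this

theorem BanachLattice.exists_add_of_abs_le_add {u x y : E} (hx : 0 ≤ x) (hy : 0 ≤ y)
    (h : |u| ≤ x + y) : ∃ u₁ u₂ : E, u = u₁ + u₂ ∧ |u₁| ≤ x ∧ |u₂| ≤ y := by
  obtain ⟨h1, h2⟩ := abs_le'.1 h
  have hux : -u ≤ y + x := by rwa [add_comm]
  refine ⟨(u ⊓ x) ⊔ (-x), u - (u ⊓ x) ⊔ (-x), by abel, abs_le'.2 ⟨?_, ?_⟩, abs_le'.2 ⟨?_, ?_⟩⟩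
  · exact sup_le inf_le_right ((neg_nonpos.2 hx).trans hx)
  · rw [neg_le]
    exact le_sup_right
  · rw [sub_le_comm]
    refine le_trans (le_inf ?_ ?_) le_sup_left
    · exact sub_le_self _ hy
    · rwa [sub_le_iff_le_add]
  · rw [neg_sub, sub_le_iff_le_add]
    refine sup_le (inf_le_left.trans (le_add_of_nonneg_left hy)) ?_
    rw [neg_le_iff_add_nonneg, ← sub_nonneg] at *
    refine hux.trans_eq (by abel)

/-- The Riesz–Kantorovich formula for the modulus of a functional, on the positive cone. -/
noncomputable def modCone (f : E →L[ℝ] ℝ) (x : E) : ℝ := sSup (f '' {u | |u| ≤ x})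

theorem modCone_bddAbove (f : E →L[ℝ] ℝ) (x : E) : BddAbove (f '' {u | |u| ≤ x}) := by
  refine ⟨‖f‖ * ‖x‖, ?_⟩
  rintro _ ⟨u, hu, rfl⟩
  exact (le_abs_self _).trans ((f.le_opNorm u).trans
    (mul_le_mul_of_nonneg_left (BanachLattice.norm_le_of_abs_le hu) (norm_nonneg _)))

theorem le_modCone (f : E →L[ℝ] ℝ) {u x : E} (h : |u| ≤ x) : f u ≤ modCone f x :=
  le_csSup (modCone_bddAbove f x) ⟨u, h, rfl⟩

theorem modCone_le (f : E →L[ℝ] ℝ) {x : E} (hx : 0 ≤ x) {c : ℝ} (h : ∀ u, |u| ≤ x → f u ≤ c) :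
    modCone f x ≤ c := by
  refine csSup_le ⟨_, 0, by simpa using hx, rfl⟩ ?_
  rintro _ ⟨u, hu, rfl⟩
  exact h u hu

theorem modCone_nonneg (f : E →L[ℝ] ℝ) {x : E} (hx : 0 ≤ x) : 0 ≤ modCone f x := by
  have := le_modCone f (u := 0) (x := x) (by simpa using hx)
  simpa using this

theorem modCone_le_norm (f : E →L[ℝ] ℝ) {x : E} (hx : 0 ≤ x) : modCone f x ≤ ‖f‖ * ‖x‖ :=
  modCone_le f hx fun u hu => (le_abs_self _).trans ((f.le_opNorm u).trans
    (mul_le_mul_of_nonneg_left (BanachLattice.norm_le_of_abs_le hu) (norm_nonneg _)))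

theorem exists_le_modCone (f : E →L[ℝ] ℝ) {x : E} (hx : 0 ≤ x) {δ : ℝ} (hδ : 0 < δ) :
    ∃ u, |u| ≤ x ∧ modCone f x ≤ f u + δ := by
  obtain ⟨_, ⟨u, hu, rfl⟩, h⟩ := exists_lt_of_lt_csSup
    (s := f '' {u | |u| ≤ x}) ⟨_, 0, by simpa using hx, rfl⟩
    (show modCone f x - δ < sSup _ from sub_lt_self _ hδ)
  exact ⟨u, hu, by linarith⟩

theorem modCone_add (f : E →L[ℝ] ℝ) {x y : E} (hx : 0 ≤ x) (hy : 0 ≤ y) :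
    modCone f (x + y) = modCone f x + modCone f y := by
  refine le_antisymm (modCone_le f (add_nonneg hx hy) fun u hu => ?_)
    (le_of_forall_pos_le_add fun δ hδ => ?_)
  · obtain ⟨u₁, u₂, rfl, h1, h2⟩ := BanachLattice.exists_add_of_abs_le_add hx hy hu
    rw [map_add]
    exact add_le_add (le_modCone f h1) (le_modCone f h2)
  · obtain ⟨u, hu, hu'⟩ := exists_le_modCone f hx (half_pos hδ)
    obtain ⟨v, hv, hv'⟩ := exists_le_modCone f hy (half_pos hδ)
    have := le_modCone f ((abs_add_le u v).trans (add_le_add hu hv))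
    rw [map_add] at this
    linarith

theorem modCone_sub_eq (f : E →L[ℝ] ℝ) {a b c d : E} (ha : 0 ≤ a) (hb : 0 ≤ b) (hc : 0 ≤ c)
    (hd : 0 ≤ d) (h : a - b = c - d) :
    modCone f a - modCone f b = modCone f c - modCone f d := by
  have h' : a + d = c + b := by
    rw [sub_eq_sub_iff_add_eq_add] at h
    exact h
  have := congrArg (modCone f) h'
  rw [modCone_add f ha hd, modCone_add f hc hb] at this
  linarith

/-- Every functional on a Banach lattice has a modulus, given by the Riesz–Kantorovich formula. -/
theorem exists_modulus (f : E →L[ℝ] ℝ) :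
    ∃ g : E →L[ℝ] ℝ, (∀ x, 0 ≤ x → g x = modCone f x) := by
  let h : E →+ ℝ :=
    { toFun := fun x => modCone f x⁺ - modCone f x⁻
      map_zero' := by simp
      map_add' := fun x y => by
        rw [modCone_sub_eq f (posPart_nonneg (x + y)) (negPart_nonneg (x + y))
          (add_nonneg (posPart_nonneg x) (posPart_nonneg y))
          (add_nonneg (negPart_nonneg x) (negPart_nonneg y)),
          modCone_add f (posPart_nonneg x) (posPart_nonneg y),
          modCone_add f (negPart_nonneg x) (negPart_nonneg y)]
        · ring
        · rw [posPart_sub_negPart, add_sub_add_comm, posPart_sub_negPart, posPart_sub_negPart] }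
  have hb : ∀ x, ‖h x‖ ≤ ‖f‖ * ‖x‖ := fun x => by
    have h1 := modCone_nonneg f (posPart_nonneg x)
    have h2 := modCone_nonneg f (negPart_nonneg x)
    have h3 := modCone_add f (posPart_nonneg x) (negPart_nonneg x)
    rw [posPart_add_negPart] at h3
    have h4 := modCone_le_norm f (abs_nonneg x)
    rw [norm_abs_eq_norm] at h4
    change |modCone f x⁺ - modCone f x⁻| ≤ _
    rw [abs_le]
    constructor <;> linarith
  have hc : Continuous h := AddMonoidHomClass.continuous_of_bound h ‖f‖ hb
  refine ⟨(h.toRealLinearMap hc), fun x hx => ?_⟩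
  change modCone f x⁺ - modCone f x⁻ = _
  rw [posPart_of_nonneg hx, negPart_of_nonneg hx]
  have h0 := modCone_add f (le_refl (0 : E)) (le_refl 0)
  rw [add_zero] at h0
  linarith

/-- The modulus of a continuous functional on a Banach lattice. -/
noncomputable def modulus (f : E →L[ℝ] ℝ) : E →L[ℝ] ℝ := (exists_modulus f).choose

theorem modulus_of_nonneg (f : E →L[ℝ] ℝ) {x : E} (hx : 0 ≤ x) : modulus f x = modCone f x :=
  (exists_modulus f).choose_spec x hx

theorem modulus_nonneg (f : E →L[ℝ] ℝ) {x : E} (hx : 0 ≤ x) : 0 ≤ modulus f x :=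
  (modulus_of_nonneg f hx).symm ▸ modCone_nonneg f hx

theorem modulus_le_norm (f : E →L[ℝ] ℝ) {x : E} (hx : 0 ≤ x) : modulus f x ≤ ‖f‖ * ‖x‖ :=
  (modulus_of_nonneg f hx).symm ▸ modCone_le_norm f hx

theorem abs_le_modulus (f : E →L[ℝ] ℝ) {u x : E} (hu : |u| ≤ x) : |f u| ≤ modulus f x := by
  rw [modulus_of_nonneg f ((abs_nonneg u).trans hu)]
  refine abs_le'.2 ⟨le_modCone f hu, ?_⟩
  rw [← map_neg]
  exact le_modCone f (by rwa [abs_neg])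

theorem norm_modulus_le (f : E →L[ℝ] ℝ) : ‖modulus f‖ ≤ ‖f‖ :=
  ContinuousLinearMap.opNorm_le_bound _ (norm_nonneg _) fun x => by
    have := BanachLattice.abs_map_le (modulus f : E →ₗ[ℝ] ℝ) (fun x hx => modulus_nonneg f hx) x
    refine this.trans ?_
    simpa [norm_abs_eq_norm] using modulus_le_norm f (abs_nonneg x)

theorem exists_le_modulus (f : E →L[ℝ] ℝ) {x : E} (hx : 0 ≤ x) {δ : ℝ} (hδ : 0 < δ) :
    ∃ u, |u| ≤ x ∧ modulus f x ≤ f u + δ :=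
  (modulus_of_nonneg f hx).symm ▸ exists_le_modCone f hx hδ

theorem exists_signs_sum_diag_le {ι : Type*} [DecidableEq ι] (s : Finset ι) (b : ι → ι → ℝ) :
    ∃ ε : ι → ℝ, (∀ i, |ε i| = 1) ∧ ∑ i ∈ s, b i i ≤ ∑ i ∈ s, ∑ j ∈ s, ε i * (ε j * b i j) := by
  induction s using Finset.induction_on with
  | empty => exact ⟨fun _ => 1, by simp, by simp⟩
  | insert k s hk ih =>
    obtain ⟨ε, hε, h⟩ := ih
    obtain ⟨t, ht, ht'⟩ : ∃ t : ℝ, |t| = 1 ∧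
        0 ≤ t * (∑ j ∈ s, ε j * b k j + ∑ j ∈ s, ε j * b j k) := by
      rcases le_total 0 (∑ j ∈ s, ε j * b k j + ∑ j ∈ s, ε j * b j k) with h0 | h0
      · exact ⟨1, by simp, by simpa using h0⟩
      · exact ⟨-1, by simp, by linarith⟩
    have hne : ∀ i ∈ s, Function.update ε k t i = ε i := fun i hi =>
      Function.update_of_ne (by rintro rfl; exact hk hi) _ _
    refine ⟨Function.update ε k t, fun i => ?_, ?_⟩
    · by_cases hi : i = k
      · subst hi; simpa using ht
      · simpa [Function.update_of_ne hi] using hε i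
    · have e1 : ∑ i ∈ s, ∑ j ∈ insert k s,
          Function.update ε k t i * (Function.update ε k t j * b i j) =
          t * ∑ j ∈ s, ε j * b j k + ∑ i ∈ s, ∑ j ∈ s, ε i * (ε j * b i j) := by
        rw [Finset.mul_sum, ← Finset.sum_add_distrib]
        refine Finset.sum_congr rfl fun i hi => ?_
        rw [Finset.sum_insert hk, hne i hi, Function.update_self]
        congr 1
        · ring
        · exact Finset.sum_congr rfl fun j hj => by rw [hne j hj]
      have e2 : ∑ j ∈ s, Function.update ε k t k * (Function.update ε k t j * b k j) =
          t * ∑ j ∈ s, ε j * b k j := by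
        rw [Finset.mul_sum]
        exact Finset.sum_congr rfl fun j hj => by rw [hne j hj, Function.update_self]
      have e3 : t * t = 1 := by rw [← abs_mul_abs_self, ht, one_mul]
      rw [Finset.sum_insert hk, Finset.sum_insert hk, Finset.sum_insert hk, e1, e2,
        Function.update_self, ← mul_assoc, e3, one_mul]
      rw [mul_add] at ht'
      linarith

/-- The diagonal part of a bounded bilinear expression is bounded. -/
theorem norm_sum_diag_comp_le {ι : Type*} [Fintype ι] [DecidableEq ι] (d : ι → E →L[ℝ] ℝ)
    (p : ι → E →L[ℝ] E) {B : ℝ} (hB : 0 ≤ B)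
    (hd : ∀ ε : ι → ℝ, (∀ i, |ε i| = 1) → ‖∑ i, ε i • d i‖ ≤ B)
    (hp : ∀ ε : ι → ℝ, (∀ i, |ε i| = 1) → ‖∑ i, ε i • p i‖ ≤ B) :
    ‖∑ i, (d i).comp (p i)‖ ≤ B * B := by
  have key : ∀ x, ∑ i, d i (p i x) ≤ B * B * ‖x‖ := fun x => by
    obtain ⟨ε, hε, h⟩ := exists_signs_sum_diag_le Finset.univ (fun i j => d i (p j x))
    refine h.trans ?_
    have : ∑ i, ∑ j, ε i * (ε j * d i (p j x)) = (∑ i, ε i • d i) ((∑ i, ε i • p i) x) := by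
      simp only [FunLike.coe_sum, Finset.sum_apply, smul_apply,
        map_sum, map_smul, smul_eq_mul, Finset.mul_sum]
      rw [Finset.sum_comm]
      refine Finset.sum_congr rfl fun i _ => Finset.sum_congr rfl fun j _ => ?_
      ring
    rw [this, mul_assoc]
    refine (Real.le_norm_self _).trans ((ContinuousLinearMap.le_opNorm _ _).trans ?_)
    refine mul_le_mul (hd ε hε) ?_ (norm_nonneg _) hB
    exact (ContinuousLinearMap.le_opNorm _ _).trans
      (mul_le_mul_of_nonneg_right (hp ε hε) (norm_nonneg _))
  refine ContinuousLinearMap.opNorm_le_bound _ (mul_nonneg hB hB) fun x => ?_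
  rw [Real.norm_eq_abs, abs_le']
  have h1 := key x
  have h2 := key (-x)
  simp only [map_neg, Finset.sum_neg_distrib, norm_neg] at h2
  constructor <;> simpa using ‹_›

/-- Moduli of functionals living on the ranges of pairwise orthogonal positive projections add
up without loss of norm. -/
theorem sum_modulus_le {κ : Type*} [Fintype κ] [DecidableEq κ] (q : κ → E →L[ℝ] E)
    (w : κ → E →L[ℝ] ℝ) (c : κ → ℝ) {K : ℝ} (hc : ∀ p, 0 ≤ c p)
    (hq : ∀ p x, 0 ≤ x → 0 ≤ q p x)
    (hqq : ∀ p p' x, q p (q p' x) = if p = p' then q p x else 0)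
    (hw : ∀ p x, w p (q p x) = w p x) (hK : 0 ≤ K)
    (hwK : ∀ u, ∑ p, c p * w p u ≤ K * ‖u‖) {y : E} (hy : 0 ≤ y) :
    ∑ p, c p * modulus (w p) (q p y) ≤ K * ‖∑ p, q p y‖ := by
  refine le_of_forall_pos_le_add fun ε hε => ?_
  have hC : 0 ≤ ∑ p, c p := Finset.sum_nonneg fun p _ => hc p
  have hC' : 0 < 1 + ∑ p, c p := by linarith
  choose u hu hu' using fun p => exists_le_modulus (w p) (hq p y hy) (div_pos hε hC')
  have hwu : ∀ p, w p (∑ p', q p' (u p')) = w p (u p) := fun p => by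
    rw [← hw p (∑ p', q p' (u p')), map_sum, ← hw p (u p)]
    simp [hqq]
  have hU : |∑ p, q p (u p)| ≤ ∑ p, q p y := by
    refine (BanachLattice.abs_sum_le _ _).trans (Finset.sum_le_sum fun p _ => ?_)
    refine (BanachLattice.abs_map_le (q p : E →ₗ[ℝ] E) (hq p) (u p)).trans ?_
    have := hq p _ (sub_nonneg.2 (hu p))
    rw [map_sub, hqq, if_pos rfl, sub_nonneg] at this
    exact this
  calc ∑ p, c p * modulus (w p) (q p y)
      ≤ ∑ p, (c p * w p (∑ p', q p' (u p')) + c p * (ε / (1 + ∑ p, c p))) :=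
        Finset.sum_le_sum fun p _ => by
          rw [hwu, ← mul_add]
          exact mul_le_mul_of_nonneg_left (hu' p) (hc p)
    _ = ∑ p, c p * w p (∑ p', q p' (u p')) + (∑ p, c p) * (ε / (1 + ∑ p, c p)) := by
        rw [Finset.sum_add_distrib, Finset.sum_mul]
    _ ≤ K * ‖∑ p, q p y‖ + ε := by
        refine add_le_add ((hwK _).trans
          (mul_le_mul_of_nonneg_left (BanachLattice.norm_le_of_abs_le hU) hK)) ?_
        rw [mul_div_assoc', div_le_iff₀ hC']
        nlinarith

/-- A derivation on matrix units, into the dual of a Banach lattice, has a positive majorant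
that is controlled by the norms of the derivation and of the actions only. -/
theorem exists_majorant_of_matrix_units {ι : Type*} [Fintype ι] [DecidableEq ι]
    (l r : ι → ι → E →L[ℝ] E) (d : ι → ι → E →L[ℝ] ℝ) {B : ℝ} (hB : 0 ≤ B)
    (hl : ∀ i j x, 0 ≤ x → 0 ≤ l i j x) (hr : ∀ i j x, 0 ≤ x → 0 ≤ r i j x)
    (hll : ∀ i j k m x, l i j (l k m x) = if j = k then l i m x else 0)
    (hrr : ∀ i j k m x, r i j (r k m x) = if m = i then r k j x else 0)
    (hlr : ∀ i j k m x, l i j (r k m x) = r k m (l i j x))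
    (hd : ∀ i j k m x, (if j = k then d i m x else 0) = d k m (r i j x) + d i j (l k m x))
    (hlB : ∀ ε : ι → ℝ, (∀ i, |ε i| = 1) → ‖∑ i, ε i • l i i‖ ≤ B)
    (hrB : ∀ ε : ι → ℝ, (∀ i, |ε i| = 1) → ‖∑ i, ε i • r i i‖ ≤ B)
    (hdB : ∀ ε : ι → ℝ, (∀ i, |ε i| = 1) → ‖∑ i, ε i • d i i‖ ≤ B) :
    ∃ v : ι → ι → E →L[ℝ] ℝ, (∀ i j x, 0 ≤ x → |d i j x| ≤ v i j x) ∧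
      ∀ (c : ι → ι → ℝ) (K : ℝ), (∀ i j, 0 ≤ c i j) → 0 ≤ K → ‖∑ i, ∑ j, c i j • l i j‖ ≤ K →
        ‖∑ i, ∑ j, c i j • r i j‖ ≤ K → ‖∑ i, ∑ j, c i j • d i j‖ ≤ K →
        ∀ x, 0 ≤ x → ∑ i, ∑ j, c i j * v i j x ≤
          (K + 2 * (B * B) * K) * (B * B) * ‖x‖ + 2 * (B * B) * K * ‖x‖ := by
  set η : E →L[ℝ] ℝ := ∑ k, (d k k).comp (l k k) with hη
  set ξ : E →L[ℝ] ℝ := ∑ k, (d k k).comp (r k k) with hξ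
  have hηB : ‖η‖ ≤ B * B := norm_sum_diag_comp_le _ _ hB hdB hlB
  have hξB : ‖ξ‖ ≤ B * B := norm_sum_diag_comp_le _ _ hB hdB hrB
  let q : ι × ι → E →L[ℝ] E := fun p => (l p.2 p.2).comp (r p.1 p.1)
  let w : ι × ι → E →L[ℝ] ℝ := fun p => (d p.1 p.2).comp (q p)
  have hq : ∀ p x, 0 ≤ x → 0 ≤ q p x := fun p x hx => hl _ _ _ (hr _ _ _ hx)
  have hqq : ∀ p p' x, q p (q p' x) = if p = p' then q p x else 0 := by
    rintro ⟨i, j⟩ ⟨i', j'⟩ x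
    change l j j (r i i (l j' j' (r i' i' x))) = _
    rw [← hlr, hll, hrr]
    by_cases h1 : j = j' <;> by_cases h2 : i' = i
    · subst h1; subst h2; simp [q]
    · have : i ≠ i' := fun h => h2 h.symm
      simp [h2, this]
    · simp [h1]
    · simp [h1]
  have hdec : ∀ i j x, d i j x = w (i, j) x + η (l i j x) + ξ (r i j x) := fun i j x => by
    have h1 := hd i j j j x
    have h2 := hd i i i j (l j j x)
    rw [if_pos rfl] at h1 h2
    have h3 : η (l i j x) = d i i (l i j x) := by
      simp [hη, hll, apply_ite]
    have h4 : ξ (r i j x) = d j j (r i j x) := by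
      simp [hξ, hrr, apply_ite]
    have h5 : w (i, j) x = d i j (r i i (l j j x)) := by
      change d i j (l j j (r i i x)) = _
      rw [hlr]
    rw [hll, if_pos rfl] at h2
    linarith
  refine ⟨fun i j => (modulus (w (i, j))).comp (q (i, j)) + (modulus η).comp (l i j) +
    (modulus ξ).comp (r i j), fun i j x hx => ?_, fun c K hc hK hlK hrK hdK x hx => ?_⟩
  · have hw : w (i, j) x = w (i, j) (q (i, j) x) := by
      change _ = d i j (q (i, j) (q (i, j) x))
      rw [hqq, if_pos rfl]
      rfl
    have h1 : |w (i, j) x| ≤ modulus (w (i, j)) (q (i, j) x) := by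
      rw [hw]
      exact abs_le_modulus _ (abs_of_nonneg (hq _ _ hx)).le
    have h2 := abs_le_modulus η (abs_of_nonneg (hl i j x hx)).le
    have h3 := abs_le_modulus ξ (abs_of_nonneg (hr i j x hx)).le
    rw [hdec]
    exact (abs_add_le _ _).trans (add_le_add ((abs_add_le _ _).trans (add_le_add h1 h2)) h3)
  · have hBB := mul_nonneg hB hB
    have elK : ∀ u, ∑ i, ∑ j, c i j • l i j u = (∑ i, ∑ j, c i j • l i j) u := fun u => by
      simp
    have erK : ∀ u, ∑ i, ∑ j, c i j • r i j u = (∑ i, ∑ j, c i j • r i j) u := fun u => by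
      simp
    have edK : ∀ u, ∑ i, ∑ j, c i j • d i j u = (∑ i, ∑ j, c i j • d i j) u := fun u => by
      simp
    have bl : ∀ u, ‖∑ i, ∑ j, c i j • l i j u‖ ≤ K * ‖u‖ := fun u => by
      rw [elK]; exact ContinuousLinearMap.le_of_opNorm_le _ hlK u
    have br : ∀ u, ‖∑ i, ∑ j, c i j • r i j u‖ ≤ K * ‖u‖ := fun u => by
      rw [erK]; exact ContinuousLinearMap.le_of_opNorm_le _ hrK u
    have bd : ∀ u, |∑ i, ∑ j, c i j • d i j u| ≤ K * ‖u‖ := fun u => by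
      rw [edK]; exact ContinuousLinearMap.le_of_opNorm_le _ hdK u
    have bη : ∀ (f : E →L[ℝ] ℝ), ‖f‖ ≤ B * B → ∀ u, ‖u‖ ≤ K * ‖x‖ →
        |f u| ≤ B * B * K * ‖x‖ := fun f hf u hu => by
      rw [mul_assoc]
      exact (f.le_opNorm u).trans (mul_le_mul hf hu (norm_nonneg _) hBB)
    have hqx : ‖∑ p, q p x‖ ≤ B * B * ‖x‖ := by
      have : ∑ p, q p x = (∑ i, (1 : ℝ) • l i i) ((∑ i, (1 : ℝ) • r i i) x) := by
        simp [Fintype.sum_prod_type, q, map_sum]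
      rw [this, mul_assoc]
      refine (ContinuousLinearMap.le_of_opNorm_le _ (hlB _ (by simp)) _).trans
        (mul_le_mul_of_nonneg_left ?_ hB)
      exact ContinuousLinearMap.le_of_opNorm_le _ (hrB _ (by simp)) _
    have hwK : ∀ u, ∑ p : ι × ι, c p.1 p.2 * w p u ≤ (K + 2 * (B * B) * K) * ‖u‖ := fun u => by
      have e : ∑ p : ι × ι, c p.1 p.2 * w p u = ∑ i, ∑ j, c i j • d i j u -
          η (∑ i, ∑ j, c i j • l i j u) - ξ (∑ i, ∑ j, c i j • r i j u) := by
        rw [Fintype.sum_prod_type]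
        simp only [map_sum, map_smul, ← Finset.sum_sub_distrib, smul_eq_mul]
        refine Finset.sum_congr rfl fun i _ => Finset.sum_congr rfl fun j _ => ?_
        rw [hdec i j u]
        ring
      have h1 := (abs_le.1 (bd u)).2
      have h2 := (abs_le.1 ((η.le_opNorm _).trans
        (mul_le_mul hηB (bl u) (norm_nonneg _) hBB))).1
      have h3 := (abs_le.1 ((ξ.le_opNorm _).trans
        (mul_le_mul hξB (br u) (norm_nonneg _) hBB))).1
      rw [e]
      nlinarith
    have hmain := sum_modulus_le q w (fun p => c p.1 p.2) (fun p => hc _ _) hq hqq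
      (fun p x => by change d _ _ (q p (q p x)) = _; rw [hqq, if_pos rfl]; rfl)
      (by positivity) hwK hx
    have hsum : ∑ i, ∑ j, c i j * ((modulus (w (i, j))).comp (q (i, j)) +
        (modulus η).comp (l i j) + (modulus ξ).comp (r i j)) x =
        ∑ p : ι × ι, c p.1 p.2 * modulus (w p) (q p x) +
          modulus η (∑ i, ∑ j, c i j • l i j x) + modulus ξ (∑ i, ∑ j, c i j • r i j x) := by
      rw [Fintype.sum_prod_type]
      simp only [map_sum, map_smul, ← Finset.sum_add_distrib, smul_eq_mul]
      refine Finset.sum_congr rfl fun i _ => Finset.sum_congr rfl fun j _ => ?_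
      simp only [add_apply, ContinuousLinearMap.comp_apply]
      ring
    have h4 := (abs_le.1 (bη _ ((norm_modulus_le η).trans hηB) _ (bl x))).2
    have h5 := (abs_le.1 (bη _ ((norm_modulus_le ξ).trans hξB) _ (br x))).2
    have h6 : (K + 2 * (B * B) * K) * ‖∑ p, q p x‖ ≤
        (K + 2 * (B * B) * K) * (B * B * ‖x‖) :=
      mul_le_mul_of_nonneg_left hqx (by positivity)
    simp only [hsum]
    nlinarith

end BanachLattice

section AtomicBasis

variable {X : Type*} [NormedAddCommGroup X] [Lattice X] [HasSolidNorm X] [IsOrderedAddMonoid X]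
  [NormedSpace ℝ X]

theorem inf_add_le_inf_add {a b u : X} (hu : 0 ≤ u) : a ⊓ (b + u) ≤ a ⊓ b + u := by
  rw [inf_add]
  exact inf_le_inf (le_add_of_nonneg_right hu) le_rfl

theorem inf_add_eq_zero {a b c : X} (ha : 0 ≤ a) (hb : 0 ≤ b) (hc : 0 ≤ c) (hab : a ⊓ b = 0)
    (hac : a ⊓ c = 0) : a ⊓ (b + c) = 0 := by
  refine le_antisymm ?_ (le_inf ha (add_nonneg hb hc))
  have h : a ⊓ (b + c) ≤ c := by
    have := inf_add_le_inf_add (a := a) (b := b) hc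
    rwa [hab, zero_add] at this
  exact hac ▸ le_inf inf_le_left h

theorem inf_nsmul_eq_zero {a b : X} (ha : 0 ≤ a) (hb : 0 ≤ b) (hab : a ⊓ b = 0) (n : ℕ) :
    a ⊓ n • b = 0 := by
  induction n with
  | zero => simpa using ha
  | succ n ih =>
    rw [succ_nsmul]
    exact inf_add_eq_zero ha (nsmul_nonneg hb n) hb ih hab

theorem inf_smul_eq_zero {a b : X} (ha : 0 ≤ a) (hb : 0 ≤ b) (hab : a ⊓ b = 0) {c : ℝ}
    (hc : 0 ≤ c) : a ⊓ c • b = 0 := by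
  obtain ⟨n, hn⟩ := exists_nat_ge c
  refine le_antisymm ?_ (le_inf ha (smul_nonneg hc hb))
  rw [← inf_nsmul_eq_zero ha hb hab n, ← Nat.cast_smul_eq_nsmul ℝ]
  exact inf_le_inf le_rfl (smul_le_smul_of_nonneg_right hn hb)

theorem inf_sum_smul_eq_zero {ι : Type*} (s : Finset ι) {a : X} (ha : 0 ≤ a) (b : ι → X)
    (hb : ∀ i ∈ s, 0 ≤ b i) (hab : ∀ i ∈ s, a ⊓ b i = 0) (c : ι → ℝ) (hc : ∀ i, 0 ≤ c i) :
    a ⊓ ∑ i ∈ s, c i • b i = 0 := by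
  classical
  induction s using Finset.induction_on with
  | empty => simpa using ha
  | insert k s hk ih =>
    rw [Finset.sum_insert hk]
    have hb' : ∀ i ∈ s, 0 ≤ b i := fun i hi => hb i (Finset.mem_insert_of_mem hi)
    exact inf_add_eq_zero ha (smul_nonneg (hc k) (hb k (Finset.mem_insert_self _ _)))
      (Finset.sum_nonneg fun i hi => smul_nonneg (hc i) (hb' i hi))
      (inf_smul_eq_zero ha (hb k (Finset.mem_insert_self _ _)) (hab k (Finset.mem_insert_self _ _))
        (hc k)) (ih hb' fun i hi => hab i (Finset.mem_insert_of_mem hi))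

theorem IsNormAtomOn.inf_eq_zero {σ : X →L[ℝ] X}
    (hriesz : ∀ y ∈ Set.range ⇑σ, ∀ z ∈ Set.range ⇑σ, y ⊔ z ∈ Set.range ⇑σ) {a b : X}
    (ha : IsNormAtomOn (Set.range ⇑σ) a) (hb : IsNormAtomOn (Set.range ⇑σ) b) (f : X →L[ℝ] ℝ)
    (hfa : f a = 1) (hfb : f b = 0) : a ⊓ b = 0 := by
  have hneg : ∀ y ∈ Set.range ⇑σ, -y ∈ Set.range ⇑σ := by
    rintro _ ⟨y, rfl⟩
    exact ⟨-y, map_neg _ _⟩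
  have hmem : a ⊓ b ∈ Set.range ⇑σ := by
    have := hneg _ (hriesz _ (hneg _ ha.1) _ (hneg _ hb.1))
    rwa [neg_sup, neg_neg, neg_neg] at this
  have h0 : 0 ≤ a ⊓ b := le_inf ha.2.1.le hb.2.1.le
  obtain ⟨c, hc⟩ := ha.2.2.2 _ hmem h0 inf_le_left
  obtain ⟨d, hd⟩ := hb.2.2.2 _ hmem h0 inf_le_right
  have hc0 : c = 0 := by
    have := congrArg f (hc.symm.trans hd)
    simpa [hfa, hfb] using this
  rw [hc, hc0, zero_smul]

/-- A basis of a sublattice consisting of atoms has positive coordinate functionals. -/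
theorem coord_nonneg {σ : X →L[ℝ] X}
    (hriesz : ∀ y ∈ Set.range ⇑σ, ∀ z ∈ Set.range ⇑σ, y ⊔ z ∈ Set.range ⇑σ)
    {x : ℕ → X} {f : ℕ → X →L[ℝ] ℝ} (hatom : ∀ i, IsNormAtomOn (Set.range ⇑σ) (x i))
    (hbi : ∀ i j, f i (x j) = if i = j then (1 : ℝ) else 0)
    (hbasis : ∀ y ∈ Set.range ⇑σ, Tendsto (fun n => eproj x f n y) atTop (𝓝 y))
    {y : X} (hyV : y ∈ Set.range ⇑σ) (hy : 0 ≤ y) (i : ℕ) : 0 ≤ f i y := by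
  by_contra! hneg
  have hx0 : ∀ j, 0 ≤ x j := fun j => (hatom j).2.1.le
  have hkey : ∀ n, i < n → -f i y ≤ ‖y - eproj x f n y‖ := fun n hn => by
    set t : X := ∑ j ∈ (Finset.range n).erase i, |f j y| • x j with ht
    have ht0 : 0 ≤ t := Finset.sum_nonneg fun j _ => smul_nonneg (abs_nonneg _) (hx0 j)
    have hdisj : t ⊓ (-f i y) • x i = 0 := by
      refine inf_smul_eq_zero ht0 (hx0 i) ?_ (neg_nonneg.2 hneg.le)
      rw [inf_comm]
      refine inf_sum_smul_eq_zero _ (hx0 i) _ (fun j _ => hx0 j) (fun j hj => ?_) _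
        fun j => abs_nonneg _
      refine (hatom i).inf_eq_zero hriesz (hatom j) (f i) (by simp [hbi]) ?_
      rw [hbi, if_neg (Finset.ne_of_mem_erase hj).symm]
    have hs : eproj x f n y = f i y • x i + ∑ j ∈ (Finset.range n).erase i, f j y • x j := by
      rw [Finset.add_sum_erase _ (fun j => f j y • x j) (Finset.mem_range.2 hn)]
      simp [eproj]
    have hle : (-f i y) • x i ≤ t + |y - eproj x f n y| := by
      have h1 : ∑ j ∈ (Finset.range n).erase i, f j y • x j ≤ t :=
        Finset.sum_le_sum fun j _ => smul_le_smul_of_nonneg_right (le_abs_self _) (hx0 j)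
      have h2 : (-f i y) • x i =
          ∑ j ∈ (Finset.range n).erase i, f j y • x j + (y - eproj x f n y) - y := by
        rw [hs, neg_smul]
        abel
      rw [h2]
      exact (sub_le_self _ hy).trans (add_le_add h1 (le_abs_self _))
    have hle' : (-f i y) • x i ≤ |y - eproj x f n y| := by
      have h3 := inf_add_le_inf_add (a := (-f i y) • x i) (b := t)
        (abs_nonneg (y - eproj x f n y))
      rwa [inf_eq_left.2 hle, inf_comm, hdisj, zero_add] at h3
    have h4 := BanachLattice.norm_mono (smul_nonneg (neg_nonneg.2 hneg.le) (hx0 i)) hle'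
    rwa [norm_smul, (hatom i).2.2.1, mul_one, Real.norm_of_nonneg (neg_nonneg.2 hneg.le),
      norm_abs_eq_norm] at h4
  have hlim : Tendsto (fun n => ‖y - eproj x f n y‖) atTop (𝓝 0) := by
    simpa using ((tendsto_const_nhds (x := y)).sub (hbasis y hyV)).norm
  have := ge_of_tendsto hlim ((eventually_gt_atTop i).mono hkey)
  linarith

theorem eproj_succ_apply (x : ℕ → X) (f : ℕ → X →L[ℝ] ℝ) (n : ℕ) (y : X) :
    eproj x f (n + 1) y = eproj x f n y + f n y • x n := by
  simp [eproj, Finset.sum_range_succ]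

theorem eproj_comp {σ : X →L[ℝ] X} (x : ℕ → X) {f : ℕ → X →L[ℝ] ℝ}
    (hfac : ∀ i, (f i).comp σ = f i) (n : ℕ) (y : X) : eproj x f n (σ y) = eproj x f n y := by
  have : ∀ i, f i (σ y) = f i y := fun i => DFunLike.congr_fun (hfac i) y
  simp [eproj, this]

theorem eproj_le {σ : X →L[ℝ] X} {x : ℕ → X} {f : ℕ → X →L[ℝ] ℝ}
    (hfac : ∀ i, (f i).comp σ = f i)
    (hbasis : ∀ y ∈ Set.range ⇑σ, Tendsto (fun n => eproj x f n y) atTop (𝓝 y))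
    (hx : ∀ i, 0 ≤ x i) (hf : ∀ i y, 0 ≤ y → 0 ≤ f i y) (n : ℕ) {y : X} (hy : 0 ≤ y) :
    eproj x f n y ≤ σ y := by
  have hmono : Monotone fun n => eproj x f n y := monotone_nat_of_le_succ fun n => by
    rw [eproj_succ_apply]
    exact le_add_of_nonneg_right (smul_nonneg (hf n y hy) (hx n))
  have hlim : Tendsto (fun n => eproj x f n y) atTop (𝓝 (σ y)) := by
    simpa only [eproj_comp x hfac] using hbasis (σ y) ⟨y, rfl⟩
  exact hmono.ge_of_tendsto hlim n

theorem abs_apply_le_of_isPosOp {T : X →L[ℝ] X} (hT : IsPosOp T) (y : X) : |T y| ≤ T |y| :=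
  BanachLattice.abs_map_le (T : X →ₗ[ℝ] X) hT y

theorem norm_le_of_dominated {T S : X →L[ℝ] X} (h : ∀ y, |T y| ≤ S |y|) : ‖T‖ ≤ ‖S‖ :=
  ContinuousLinearMap.opNorm_le_bound _ (norm_nonneg _) fun y => by
    refine (BanachLattice.norm_le_of_abs_le (h y)).trans ((S.le_opNorm _).trans ?_)
    rw [norm_abs_eq_norm]

end AtomicBasis

section RegularNorm

variable {X : Type*} [NormedAddCommGroup X] [Lattice X] [HasSolidNorm X] [IsOrderedAddMonoid X]
  [NormedSpace ℝ X]

/-- `S` dominates `T`, as in the definition of the regular norm. -/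
def IsDominatedBy (T S : X →L[ℝ] X) : Prop := ∀ x, |T x| ≤ S |x|

theorem IsPosOp.isDominatedBy {T : X →L[ℝ] X} (hT : IsPosOp T) : IsDominatedBy T T :=
  abs_apply_le_of_isPosOp hT

theorem IsDominatedBy.isPosOp {T S : X →L[ℝ] X} (h : IsDominatedBy T S) : IsPosOp S :=
  fun x hx => (abs_nonneg _).trans ((h x).trans_eq (by rw [abs_of_nonneg hx]))

theorem isDominatedBy_zero : IsDominatedBy (0 : X →L[ℝ] X) 0 := fun x => by simp

theorem IsDominatedBy.add {T T' S S' : X →L[ℝ] X} (h : IsDominatedBy T S)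
    (h' : IsDominatedBy T' S') : IsDominatedBy (T + T') (S + S') :=
  fun x => (abs_add_le _ _).trans (add_le_add (h x) (h' x))

theorem IsDominatedBy.smul {T S : X →L[ℝ] X} (h : IsDominatedBy T S) (c : ℝ) :
    IsDominatedBy (c • T) (|c| • S) :=
  fun x => (BanachLattice.abs_smul_le c (T x)).trans
    (smul_le_smul_of_nonneg_left (h x) (abs_nonneg c))

theorem IsDominatedBy.sub {T T' S S' : X →L[ℝ] X} (h : IsDominatedBy T S)
    (h' : IsDominatedBy T' S') : IsDominatedBy (T - T') (S + S') := by
  simpa [sub_eq_add_neg] using h.add (h'.smul (-1))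

theorem IsDominatedBy.sum {ι : Type*} (s : Finset ι) {T S : ι → X →L[ℝ] X}
    (h : ∀ i ∈ s, IsDominatedBy (T i) (S i)) : IsDominatedBy (∑ i ∈ s, T i) (∑ i ∈ s, S i) := by
  intro x
  simp only [FunLike.coe_sum, Finset.sum_apply]
  exact (BanachLattice.abs_sum_le _ _).trans (Finset.sum_le_sum fun i hi => h i hi x)

theorem IsDominatedBy.comp {T T' S S' : X →L[ℝ] X} (h : IsDominatedBy T S)
    (h' : IsDominatedBy T' S') : IsDominatedBy (T ∘L T') (S ∘L S') := fun x => by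
  refine (h (T' x)).trans ?_
  have := h.isPosOp _ (sub_nonneg.2 (h' x))
  rwa [map_sub, sub_nonneg] at this

theorem isDominatedBy_smulRight (f : X →L[ℝ] ℝ) (v : X) :
    IsDominatedBy (f.smulRight v) ((modulus f).smulRight |v|) := fun x => by
  refine (BanachLattice.abs_smul_le (f x) v).trans ?_
  exact smul_le_smul_of_nonneg_right (abs_le_modulus f le_rfl) (abs_nonneg v)

theorem norm_modulus_smulRight_le (f : X →L[ℝ] ℝ) (v : X) :
    ‖(modulus f).smulRight |v|‖ ≤ ‖f‖ * ‖v‖ := by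
  rw [ContinuousLinearMap.norm_smulRight_apply, norm_abs_eq_norm]
  exact mul_le_mul_of_nonneg_right (norm_modulus_le f) (norm_nonneg v)

theorem rnorm_nonneg (T : X →L[ℝ] X) : 0 ≤ rnorm T :=
  Real.sInf_nonneg (by rintro _ ⟨S, rfl, -⟩; exact norm_nonneg S)

theorem IsDominatedBy.rnorm_le {T S : X →L[ℝ] X} (h : IsDominatedBy T S) : rnorm T ≤ ‖S‖ := by
  refine csInf_le ⟨0, ?_⟩ ⟨S, rfl, h⟩
  rintro _ ⟨S, rfl, -⟩
  exact norm_nonneg S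

theorem IsDominatedBy.exists_norm_lt {T S : X →L[ℝ] X} (h : IsDominatedBy T S) {c : ℝ}
    (hc : rnorm T < c) : ∃ S', IsDominatedBy T S' ∧ ‖S'‖ < c := by
  have hne : {c : ℝ | ∃ S : X →L[ℝ] X, ‖S‖ = c ∧ ∀ x : X, |T x| ≤ S |x|}.Nonempty :=
    ⟨_, S, rfl, h⟩
  obtain ⟨_, ⟨S', rfl, h'⟩, hlt⟩ := exists_lt_of_csInf_lt hne hc
  exact ⟨S', h', hlt⟩

theorem mem_LrSet_iff {T : X →L[ℝ] X} :
    T ∈ LrSet X ↔ T ∈ Submodule.span ℝ {S : X →L[ℝ] X | IsPosOp S} := by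
  rw [Submodule.mem_span_set']
  constructor
  · rintro ⟨n, c, S, hS, rfl⟩
    exact ⟨n, c, fun i => ⟨S i, hS i⟩, rfl⟩
  · rintro ⟨n, c, S, rfl⟩
    exact ⟨n, c, fun i => S i, fun i => (S i).2, rfl⟩

theorem finRankOp_iff {T : X →L[ℝ] X} :
    FinRankOp T ↔ T ∈ Submodule.span ℝ
      {S : X →L[ℝ] X | ∃ (f : X →L[ℝ] ℝ) (v : X), S = f.smulRight v} := by
  constructor
  · rintro ⟨n, f, v, rfl⟩
    exact Submodule.sum_mem _ fun i _ => Submodule.subset_span ⟨f i, v i, rfl⟩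
  · rw [Submodule.mem_span_set']
    rintro ⟨n, c, S, rfl⟩
    choose f v hfv using fun i => (S i).2
    refine ⟨n, fun i => c i • f i, v, Finset.sum_congr rfl fun i _ => ?_⟩
    rw [hfv]
    ext x
    simp [mul_smul]

theorem LrSet.exists_isDominatedBy {T : X →L[ℝ] X} (hT : T ∈ LrSet X) :
    ∃ S, IsDominatedBy T S := by
  obtain ⟨n, c, S, hS, rfl⟩ := hT
  exact ⟨_, IsDominatedBy.sum _ fun i _ => (hS i).isDominatedBy.smul (c i)⟩

theorem FinRankOp.exists_isDominatedBy {T : X →L[ℝ] X} (hT : FinRankOp T) :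
    ∃ S, IsDominatedBy T S := by
  obtain ⟨n, f, v, rfl⟩ := hT
  exact ⟨_, IsDominatedBy.sum _ fun i _ => isDominatedBy_smulRight (f i) (v i)⟩

theorem mem_ArSet_iff {T : X →L[ℝ] X} : T ∈ ArSet X ↔ T ∈ LrSet X ∧ ∀ ε : ℝ, 0 < ε →
    ∃ F S : X →L[ℝ] X, FinRankOp F ∧ IsDominatedBy (T - F) S ∧ ‖S‖ < ε := by
  refine and_congr_right fun hT => forall₂_congr fun ε _ => exists_congr fun F => ?_
  constructor
  · rintro ⟨hF, h⟩
    obtain ⟨S, hS⟩ := LrSet.exists_isDominatedBy hT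
    obtain ⟨S', hS'⟩ := hF.exists_isDominatedBy
    obtain ⟨R, hR, hlt⟩ := (hS.sub hS').exists_norm_lt h
    exact ⟨R, hF, hR, hlt⟩
  · rintro ⟨S, hF, hS, hlt⟩
    exact ⟨hF, hS.rnorm_le.trans_lt hlt⟩

/-- `𝒜ʳ(X)` as a linear subspace. -/
def arSubmodule (X : Type*) [NormedAddCommGroup X] [Lattice X] [HasSolidNorm X]
    [IsOrderedAddMonoid X] [NormedSpace ℝ X] : Submodule ℝ (X →L[ℝ] X) where
  carrier := ArSet X
  zero_mem' := mem_ArSet_iff.2 ⟨mem_LrSet_iff.2 (Submodule.zero_mem _), fun ε hε =>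
    ⟨0, 0, finRankOp_iff.2 (Submodule.zero_mem _), by simpa using isDominatedBy_zero,
      by simpa using hε⟩⟩
  add_mem' := by
    intro a b ha hb
    rw [mem_ArSet_iff] at *
    refine ⟨mem_LrSet_iff.2 (Submodule.add_mem _ (mem_LrSet_iff.1 ha.1) (mem_LrSet_iff.1 hb.1)),
      fun ε hε => ?_⟩
    obtain ⟨F, S, hF, hS, hlt⟩ := ha.2 _ (half_pos hε)
    obtain ⟨G, R, hG, hR, hlt'⟩ := hb.2 _ (half_pos hε)
    refine ⟨F + G, S + R, finRankOp_iff.2 (Submodule.add_mem _ (finRankOp_iff.1 hF)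
      (finRankOp_iff.1 hG)), ?_, (norm_add_le _ _).trans_lt (by linarith)⟩
    rw [add_sub_add_comm]
    exact hS.add hR
  smul_mem' := by
    intro c a ha
    change c • a ∈ ArSet X
    change a ∈ ArSet X at ha
    rw [mem_ArSet_iff] at *
    refine ⟨mem_LrSet_iff.2 (Submodule.smul_mem _ _ (mem_LrSet_iff.1 ha.1)), fun ε hε => ?_⟩
    have hc : 0 < |c| + 1 := by positivity
    obtain ⟨F, S, hF, hS, hlt⟩ := ha.2 _ (div_pos hε hc)
    refine ⟨c • F, |c| • S, finRankOp_iff.2 (Submodule.smul_mem _ _ (finRankOp_iff.1 hF)), ?_, ?_⟩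
    · rw [← smul_sub]
      exact hS.smul c
    · rw [norm_smul, Real.norm_eq_abs, abs_abs]
      rw [lt_div_iff₀ hc] at hlt
      nlinarith [norm_nonneg S]

theorem smulRight_mem_ArSet {f : X →L[ℝ] ℝ} {v : X} (h : IsPosOp (f.smulRight v)) :
    f.smulRight v ∈ ArSet X := by
  refine mem_ArSet_iff.2 ⟨mem_LrSet_iff.2 (Submodule.subset_span h), fun ε hε =>
    ⟨f.smulRight v, 0, finRankOp_iff.2 (Submodule.subset_span ⟨f, v, rfl⟩), ?_, by simpa using hε⟩⟩
  rw [sub_self]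
  exact isDominatedBy_zero

/-- Elements of `𝒜ʳ(X)` are approximated in regular norm by their compressions along a bounded
approximate identity. -/
theorem tendsto_rnorm_sub_comp {α : Type*} {l : Filter α} {e : α → X →L[ℝ] X} {C : ℝ}
    (hpos : ∀ t, IsPosOp (e t)) (hC : ∀ t, ‖e t‖ ≤ C)
    (hv : ∀ v, Tendsto (fun t => ‖v - e t v‖) l (𝓝 0))
    (hf : ∀ f : X →L[ℝ] ℝ, Tendsto (fun t => ‖f - f ∘L e t‖) l (𝓝 0)) {a : X →L[ℝ] X}
    (ha : a ∈ ArSet X) : Tendsto (fun t => rnorm (a - e t ∘L a ∘L e t)) l (𝓝 0) := by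
  rcases isEmpty_or_nonempty α with hα | ⟨⟨t₀⟩⟩
  · rw [Filter.filter_eq_bot_of_isEmpty l]
    exact tendsto_bot
  have hC0 : 0 ≤ C := (norm_nonneg _).trans (hC t₀)
  rw [Metric.tendsto_nhds]
  intro ε hε
  have hC1 : 0 < 1 + C * C := by positivity
  obtain ⟨F, S, ⟨m, f, v, rfl⟩, hS, hlt⟩ := (mem_ArSet_iff.1 ha).2 _ (div_pos (half_pos hε) hC1)
  have hlim : Tendsto (fun t => ∑ k, (‖f k - f k ∘L e t‖ * (C * ‖v k‖) +
      ‖f k‖ * ‖v k - e t (v k)‖)) l (𝓝 0) := by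
    have : Tendsto (fun t => ∑ k, (‖f k - f k ∘L e t‖ * (C * ‖v k‖) +
        ‖f k‖ * ‖v k - e t (v k)‖)) l (𝓝 (∑ k : Fin m, (0 * (C * ‖v k‖) + ‖f k‖ * 0))) :=
      tendsto_finsetSum _ fun k _ => ((hf (f k)).mul_const _).add ((hv (v k)).const_mul _)
    simpa using this
  filter_upwards [hlim.eventually (gt_mem_nhds (half_pos hε))] with t ht
  have hcompl : IsDominatedBy ((a - ∑ i, (f i).smulRight (v i)) -
      e t ∘L ((a - ∑ i, (f i).smulRight (v i)) ∘L e t)) (S + e t ∘L (S ∘L e t)) :=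
    hS.sub ((hpos t).isDominatedBy.comp (hS.comp (hpos t).isDominatedBy))
  have hfin : IsDominatedBy (∑ k, ((f k - f k ∘L e t).smulRight (e t (v k)) +
      (f k).smulRight (v k - e t (v k))))
      (∑ k, ((modulus (f k - f k ∘L e t)).smulRight |e t (v k)| +
        (modulus (f k)).smulRight |v k - e t (v k)|)) :=
    IsDominatedBy.sum _ fun k _ => (isDominatedBy_smulRight _ _).add (isDominatedBy_smulRight _ _)
  have hsum : a - e t ∘L a ∘L e t = ((a - ∑ i, (f i).smulRight (v i)) -
      e t ∘L ((a - ∑ i, (f i).smulRight (v i)) ∘L e t)) +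
      ∑ k, ((f k - f k ∘L e t).smulRight (e t (v k)) + (f k).smulRight (v k - e t (v k))) := by
    ext x
    simp only [sub_apply, add_apply, ContinuousLinearMap.comp_apply, FunLike.coe_sum,
      Finset.sum_apply, ContinuousLinearMap.smulRight_apply, map_sub, map_sum, map_smul, sub_smul,
      smul_sub, Finset.sum_add_distrib, Finset.sum_sub_distrib]
    abel
  rw [Real.dist_eq, sub_zero, abs_of_nonneg (rnorm_nonneg _), hsum]
  refine (hcompl.add hfin).rnorm_le.trans_lt ((norm_add_le _ _).trans_lt ?_)
  have h1 : ‖S + e t ∘L (S ∘L e t)‖ ≤ ‖S‖ * (1 + C * C) := by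
    refine (norm_add_le _ _).trans ?_
    have : ‖e t ∘L (S ∘L e t)‖ ≤ C * (‖S‖ * C) :=
      (ContinuousLinearMap.opNorm_comp_le _ _).trans (mul_le_mul (hC t)
        ((ContinuousLinearMap.opNorm_comp_le _ _).trans
          (mul_le_mul_of_nonneg_left (hC t) (norm_nonneg _))) (norm_nonneg _) hC0)
    linarith
  have h2 : ‖∑ k, ((modulus (f k - f k ∘L e t)).smulRight |e t (v k)| +
      (modulus (f k)).smulRight |v k - e t (v k)|)‖ ≤
      ∑ k, (‖f k - f k ∘L e t‖ * (C * ‖v k‖) + ‖f k‖ * ‖v k - e t (v k)‖) := by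
    refine (norm_sum_le _ _).trans (Finset.sum_le_sum fun k _ => (norm_add_le _ _).trans
      (add_le_add ((norm_modulus_smulRight_le _ _).trans ?_) (norm_modulus_smulRight_le _ _)))
    exact mul_le_mul_of_nonneg_left (ContinuousLinearMap.le_of_opNorm_le _ (hC t) _)
      (norm_nonneg _)
  rw [lt_div_iff₀ hC1] at hlt
  linarith

end RegularNorm

section GeneratingSystem

variable {X : Type*} [NormedAddCommGroup X] [Lattice X] [HasSolidNorm X] [IsOrderedAddMonoid X]
  [NormedSpace ℝ X]

theorem eventually_piFilter {P : Set (X →L[ℝ] X)} {σ₀ : X →L[ℝ] X} (h : σ₀ ∈ P) :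
    ∀ᶠ σ : {σ : X →L[ℝ] X // σ ∈ P} in piFilter P, Set.range ⇑σ₀ ⊆ Set.range ⇑σ.val :=
  mem_iInf_of_mem ⟨σ₀, h⟩ (mem_principal_self _)

theorem piFilter_neBot {P : Set (X →L[ℝ] X)} (hne : P.Nonempty)
    (hdir : ∀ σ₁ ∈ P, ∀ σ₂ ∈ P, ∃ σ₃ ∈ P,
      Set.range ⇑σ₁ ⊆ Set.range ⇑σ₃ ∧ Set.range ⇑σ₂ ⊆ Set.range ⇑σ₃) : (piFilter P).NeBot := by
  obtain ⟨σ₀, h₀⟩ := hne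
  have : Nonempty {σ : X →L[ℝ] X // σ ∈ P} := ⟨⟨σ₀, h₀⟩⟩
  refine iInf_neBot_of_directed ?_ fun σ => principal_neBot_iff.2 ⟨σ, Set.Subset.rfl⟩
  rintro ⟨σ₁, h₁⟩ ⟨σ₂, h₂⟩
  obtain ⟨σ₃, h₃, h13, h23⟩ := hdir σ₁ h₁ σ₂ h₂
  exact ⟨⟨σ₃, h₃⟩, principal_mono.2 fun σ hσ => h13.trans hσ,
    principal_mono.2 fun σ hσ => h23.trans hσ⟩

theorem curry_neBot {α β : Type*} {f : Filter α} {g : Filter β} [f.NeBot] [g.NeBot] :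
    (f.curry g).NeBot := by
  refine ⟨fun h => ?_⟩
  have hF : ∀ᶠ _ in f.curry g, False := by
    rw [h]
    exact eventually_bot
  rw [eventually_curry_iff] at hF
  simp [NeBot.ne ‹f.NeBot›, NeBot.ne ‹g.NeBot›] at hF

theorem tendsto_norm_sub_apply_curry {P : Set (X →L[ℝ] X)} {C : ℝ} (hC0 : 0 ≤ C)
    (hdense : ∀ (ξ : X) (ε : ℝ), 0 < ε → ∃ σ ∈ P, ∃ y ∈ Set.range ⇑σ, ‖ξ - y‖ < ε)
    {e : (X →L[ℝ] X) → ℕ → X →L[ℝ] X} (heC : ∀ σ ∈ P, ∀ n, ‖e σ n‖ ≤ C)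
    (hbasis : ∀ σ ∈ P, ∀ y ∈ Set.range ⇑σ, Tendsto (fun n => e σ n y) atTop (𝓝 y)) (v : X) :
    Tendsto (fun t : {σ : X →L[ℝ] X // σ ∈ P} × ℕ => ‖v - e t.1 t.2 v‖)
      ((piFilter P).curry atTop) (𝓝 0) := by
  rw [Metric.tendsto_nhds]
  intro ε hε
  rw [eventually_curry_iff]
  have hC1 : 0 < 1 + C := by linarith
  obtain ⟨σ₀, hσ₀, y, hy, hvy⟩ := hdense v _ (div_pos (half_pos hε) hC1)
  filter_upwards [eventually_piFilter hσ₀] with σ hσ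
  have h := Metric.tendsto_nhds.1 (hbasis σ σ.2 y (hσ hy)) _ (half_pos hε)
  filter_upwards [h] with n hn
  rw [dist_eq_norm] at hn
  rw [Real.dist_eq, sub_zero, abs_norm]
  have h1 : v - e σ n v = (v - y) - (e σ n y - y) - e σ n (v - y) := by
    rw [map_sub]
    abel
  rw [h1]
  refine (norm_sub_le _ _).trans_lt ?_
  have h2 := norm_sub_le (v - y) (e σ n y - y)
  have h3 := ContinuousLinearMap.le_of_opNorm_le _ (heC σ σ.2 n) (v - y)
  rw [lt_div_iff₀ hC1] at hvy
  linarith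

theorem abs_sub_le_sSup_mul {V : Set X} (hV : ∀ (c : ℝ), ∀ y ∈ V, c • y ∈ V) (l : X →L[ℝ] ℝ)
    (e : X →L[ℝ] X) {y : X} (hy : y ∈ V) :
    |l y - l (e y)| ≤ sSup {r : ℝ | ∃ y ∈ V, ‖y‖ ≤ 1 ∧ r = |l y - l (e y)|} * ‖y‖ := by
  rcases eq_or_ne y 0 with rfl | hy0
  · simp
  have hpos : 0 < ‖y‖ := norm_pos_iff.2 hy0
  rw [← div_le_iff₀ hpos]
  refine le_csSup ⟨‖l - l ∘L e‖, ?_⟩ ⟨‖y‖⁻¹ • y, hV _ _ hy, ?_, ?_⟩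
  · rintro _ ⟨z, -, hz, rfl⟩
    exact (l - l ∘L e).unit_le_opNorm z hz
  · rw [norm_smul, norm_inv, norm_norm, inv_mul_cancel₀ hpos.ne']
  · rw [map_smul, map_smul, map_smul, ← smul_sub, smul_eq_mul, abs_mul, abs_inv, abs_norm,
      div_eq_inv_mul]

theorem tendsto_norm_sub_comp_curry {P : Set (X →L[ℝ] X)} {C : ℝ} (hC0 : 0 ≤ C)
    (hC : ∀ σ ∈ P, ‖σ‖ ≤ C) {e : (X →L[ℝ] X) → ℕ → X →L[ℝ] X}
    (hfac : ∀ σ ∈ P, ∀ n y, e σ n (σ y) = e σ n y)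
    (hshrink : ∀ σ ∈ P, ∀ l : X →L[ℝ] ℝ, Tendsto (fun n => sSup {r : ℝ | ∃ y ∈ Set.range ⇑σ,
      ‖y‖ ≤ 1 ∧ r = |l y - l (e σ n y)|}) atTop (𝓝 0))
    (hdual : ∀ l : X →L[ℝ] ℝ, Tendsto (fun σ : {σ : X →L[ℝ] X // σ ∈ P} => ‖l - l.comp σ.val‖)
      (piFilter P) (𝓝 0)) (f : X →L[ℝ] ℝ) :
    Tendsto (fun t : {σ : X →L[ℝ] X // σ ∈ P} × ℕ => ‖f - f ∘L e t.1 t.2‖)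
      ((piFilter P).curry atTop) (𝓝 0) := by
  rw [Metric.tendsto_nhds]
  intro ε hε
  rw [eventually_curry_iff]
  have hC1 : 0 < 1 + C := by linarith
  filter_upwards [(hdual f).eventually (gt_mem_nhds (half_pos hε))] with σ hσ
  filter_upwards [(hshrink σ σ.2 f).eventually (gt_mem_nhds (div_pos (half_pos hε) hC1))] with n hn
  rw [Real.dist_eq, sub_zero, abs_norm]
  set s := sSup {r : ℝ | ∃ y ∈ Set.range ⇑σ.val, ‖y‖ ≤ 1 ∧ r = |f y - f (e σ n y)|} with hs
  have hs0 : 0 ≤ s := Real.sSup_nonneg (by rintro _ ⟨y, -, -, rfl⟩; exact abs_nonneg _)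
  have hle : ‖f - f ∘L e σ n‖ ≤ ‖f - f.comp σ.val‖ + s * C := by
    refine ContinuousLinearMap.opNorm_le_bound _ (by positivity) fun y => ?_
    have h1 : (f - f ∘L e σ n) y = (f - f.comp σ.val) y + (f (σ.val y) - f (e σ n (σ.val y))) := by
      simp only [sub_apply, ContinuousLinearMap.comp_apply, hfac σ σ.2]
      ring
    have h2 := abs_sub_le_sSup_mul (V := Set.range ⇑σ.val)
      (by rintro c _ ⟨z, rfl⟩; exact ⟨c • z, map_smul _ _ _⟩) f (e σ n) ⟨y, rfl⟩
    have h3 := mul_le_mul_of_nonneg_left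
      (ContinuousLinearMap.le_of_opNorm_le _ (hC σ σ.2) y) hs0
    have h4 := (f - f.comp σ.val).le_opNorm y
    rw [h1]
    refine (norm_add_le _ _).trans ?_
    rw [Real.norm_eq_abs (f _ - _)]
    linarith
  rw [lt_div_iff₀ hC1] at hn
  linarith

end GeneratingSystem

section Derivation

variable {X Y : Type*} [NormedAddCommGroup X] [Lattice X] [HasSolidNorm X] [IsOrderedAddMonoid X]
  [NormedSpace ℝ X] [NormedAddCommGroup Y] [Lattice Y] [HasSolidNorm Y] [IsOrderedAddMonoid Y]
  [NormedSpace ℝ Y]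

/-- The compressions of a bounded derivation to the spans of finitely many positive matrix units
have positive majorants, bounded independently of the number of matrix units. -/
theorem exists_compression_majorant (L R : arSubmodule X →ₗ[ℝ] (Y →L[ℝ] Y))
    (D : arSubmodule X →ₗ[ℝ] (Y →L[ℝ] ℝ)) {N C : ℝ} (hN : 0 ≤ N) (hC : 0 ≤ C)
    (hLmul : ∀ a b c : arSubmodule X, (c : X →L[ℝ] X) = a.1 ∘L b.1 → ∀ y, L c y = L a (L b y))
    (hRmul : ∀ a b c : arSubmodule X, (c : X →L[ℝ] X) = a.1 ∘L b.1 → ∀ y, R c y = R b (R a y))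
    (hLR : ∀ a b : arSubmodule X, ∀ y, L a (R b y) = R b (L a y))
    (hD : ∀ a b c : arSubmodule X, (c : X →L[ℝ] X) = a.1 ∘L b.1 →
      ∀ y, D c y = D b (R a y) + D a (L b y))
    (hLpos : ∀ a : arSubmodule X, IsPosOp a.1 → ∀ y, 0 ≤ y → 0 ≤ L a y)
    (hRpos : ∀ a : arSubmodule X, IsPosOp a.1 → ∀ y, 0 ≤ y → 0 ≤ R a y)
    (hLN : ∀ a, ‖L a‖ ≤ N * rnorm a.1) (hRN : ∀ a, ‖R a‖ ≤ N * rnorm a.1)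
    (hDN : ∀ a, ‖D a‖ ≤ N * rnorm a.1) (x : ℕ → X) (f : ℕ → X →L[ℝ] ℝ) (hx : ∀ i, 0 ≤ x i)
    (hf : ∀ i y, 0 ≤ y → 0 ≤ f i y) (hbi : ∀ i j, f i (x j) = if i = j then (1 : ℝ) else 0)
    (n : ℕ) (he : ‖eproj x f n‖ ≤ C) :
    ∃ V : (X →L[ℝ] X) →ₗ[ℝ] (Y →L[ℝ] ℝ),
      (∀ a, IsPosOp a → ∀ y, 0 ≤ y → 0 ≤ V a y) ∧
      (∀ a : arSubmodule X, IsPosOp a.1 → ∀ y, 0 ≤ y →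
        D a y ≤ V a y + N * rnorm (a.1 - eproj x f n ∘L a.1 ∘L eproj x f n) * ‖y‖) ∧
      ∀ a, IsPosOp a → ∀ y, 0 ≤ y → V a y ≤
        (((N * (C * C) + 2 * (N * C * (N * C)) * (N * (C * C))) * (N * C * (N * C)) +
          2 * (N * C * (N * C)) * (N * (C * C))) * ‖a‖) * ‖y‖ := by
  have hB : 0 ≤ N * C := mul_nonneg hN hC
  have hEpos : ∀ i j, IsPosOp ((f j).smulRight (x i)) := fun i j y hy =>
    smul_nonneg (hf j y hy) (hx i)
  let E : Fin n → Fin n → arSubmodule X := fun i j =>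
    ⟨(f j).smulRight (x i), smulRight_mem_ArSet (hEpos i j)⟩
  have hE : ∀ i j y, (E i j).1 y = f j y • x i := fun i j y => rfl
  have hEE : ∀ i j k m, ((if j = k then E i m else 0 : arSubmodule X) : X →L[ℝ] X) =
      (E i j).1 ∘L (E k m).1 := fun i j k m => by
    ext z
    have hjk : f j (x k) = if j = k then (1 : ℝ) else 0 := by simp [hbi, Fin.ext_iff]
    by_cases h : j = k
    · simp [h, hE, hbi]
    · simp [h, hE, hjk]
  have hediag : ∀ y, eproj x f n y = ∑ i, (E i i).1 y := fun y => by
    simp [eproj, Finset.sum_range, hE]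
  have hsigns : ∀ ε : Fin n → ℝ, (∀ i, |ε i| = 1) →
      rnorm (∑ i, ε i • E i i : arSubmodule X).1 ≤ C := fun ε hε => by
    refine le_trans (IsDominatedBy.rnorm_le (S := eproj x f n) fun y => ?_) he
    rw [hediag]
    have : (∑ i, ε i • E i i : arSubmodule X).1 y = ∑ i, ε i • (E i i).1 y := by simp
    rw [this]
    refine (BanachLattice.abs_sum_le _ _).trans (Finset.sum_le_sum fun i _ => ?_)
    refine (BanachLattice.abs_smul_le _ _).trans ?_
    rw [hε, one_smul]
    exact abs_apply_le_of_isPosOp (hEpos i i) y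
  obtain ⟨v, hv, hvK⟩ := exists_majorant_of_matrix_units (fun i j => L (E i j))
    (fun i j => R (E i j)) (fun i j => D (E i j)) hB
    (fun i j y hy => hLpos _ (hEpos i j) y hy) (fun i j y hy => hRpos _ (hEpos i j) y hy)
    (fun i j k m y => by
      rw [← hLmul _ _ _ (hEE i j k m)]
      split_ifs <;> simp)
    (fun i j k m y => by
      rw [← hRmul _ _ _ (hEE k m i j)]
      split_ifs <;> simp)
    (fun i j k m y => hLR _ _ _)
    (fun i j k m y => by
      rw [← hD _ _ _ (hEE i j k m)]
      split_ifs <;> simp)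
    (fun ε hε => by
      simp only [← map_smul, ← map_sum]
      exact (hLN _).trans (mul_le_mul_of_nonneg_left (hsigns ε hε) hN))
    (fun ε hε => by
      simp only [← map_smul, ← map_sum]
      exact (hRN _).trans (mul_le_mul_of_nonneg_left (hsigns ε hε) hN))
    (fun ε hε => by
      simp only [← map_smul, ← map_sum]
      exact (hDN _).trans (mul_le_mul_of_nonneg_left (hsigns ε hε) hN))
  let V : (X →L[ℝ] X) →ₗ[ℝ] (Y →L[ℝ] ℝ) :=
    { toFun := fun a => ∑ i : Fin n, ∑ j : Fin n, f i (a (x j)) • v i j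
      map_add' := fun a b => by
        simp only [add_apply, map_add, add_smul, Finset.sum_add_distrib]
      map_smul' := fun c a => by
        simp only [smul_apply, map_smul, smul_eq_mul, mul_smul, Finset.smul_sum,
          RingHom.id_apply] }
  have hV : ∀ a y, V a y = ∑ i : Fin n, ∑ j : Fin n, f i (a (x j)) * v i j y := fun a y => by
    simp [V]
  have hc : ∀ a, IsPosOp a → ∀ i j : ℕ, 0 ≤ f i (a (x j)) := fun a ha i j => hf _ _ (ha _ (hx j))
  have heae : ∀ a : X →L[ℝ] X,
      (∑ i : Fin n, ∑ j : Fin n, f i (a (x j)) • E i j : arSubmodule X).1 = eproj x f n ∘L a ∘L eproj x f n := fun a => by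
    ext z
    simp only [ContinuousLinearMap.comp_apply, hediag, hE, map_sum, map_smul, Finset.sum_smul,
      Submodule.coe_sum, Submodule.coe_smul, FunLike.coe_sum, Finset.sum_apply, smul_apply,
      smul_eq_mul, mul_smul]
    exact Finset.sum_congr rfl fun i _ => Finset.sum_congr rfl fun j _ => smul_comm _ _ _
  have hepos : IsPosOp (eproj x f n) := fun y hy => by
    rw [hediag]
    exact Finset.sum_nonneg fun i _ => hEpos i i y hy
  refine ⟨V, fun a ha y hy => ?_, fun a ha y hy => ?_, fun a ha y hy => ?_⟩
  · rw [hV]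
    exact Finset.sum_nonneg fun i _ => Finset.sum_nonneg fun j _ =>
      mul_nonneg (hc a ha i j) ((abs_nonneg _).trans (hv i j y hy))
  · set b : arSubmodule X := ∑ i : Fin n, ∑ j : Fin n, f i (a.1 (x j)) • E i j with hb
    have h1 : D b y ≤ V a y := by
      rw [hV, hb]
      simp only [map_sum, map_smul, FunLike.coe_sum, Finset.sum_apply, smul_apply, smul_eq_mul]
      exact Finset.sum_le_sum fun i _ => Finset.sum_le_sum fun j _ =>
        mul_le_mul_of_nonneg_left ((le_abs_self _).trans (hv i j y hy)) (hc a ha i j)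
    have h2 := ContinuousLinearMap.le_of_opNorm_le _ (hDN (a - b)) y
    have h3 : (a - b : arSubmodule X).1 = a.1 - eproj x f n ∘L a.1 ∘L eproj x f n := by
      rw [← heae]
      rfl
    rw [h3, map_sub, sub_apply] at h2
    have := (Real.le_norm_self _).trans h2
    linarith
  · have hr : rnorm (∑ i : Fin n, ∑ j : Fin n, f i (a (x j)) • E i j : arSubmodule X).1 ≤ C * C * ‖a‖ := by
      rw [heae]
      refine (IsDominatedBy.rnorm_le (hepos.isDominatedBy.comp
        (ha.isDominatedBy.comp hepos.isDominatedBy))).trans ?_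
      refine (ContinuousLinearMap.opNorm_comp_le _ _).trans ((mul_le_mul he
        ((ContinuousLinearMap.opNorm_comp_le _ _).trans
          (mul_le_mul_of_nonneg_left he (norm_nonneg _))) (norm_nonneg _) hC).trans_eq ?_)
      ring
    have hr' := mul_le_mul_of_nonneg_left hr hN
    have h := hvK (fun i j : Fin n => f i (a (x j))) (N * (C * C * ‖a‖)) (fun i j => hc a ha i j)
      (by positivity)
      (by simp only [← map_smul, ← map_sum]; exact (hLN _).trans hr')
      (by simp only [← map_smul, ← map_sum]; exact (hRN _).trans hr')
      (by simp only [← map_smul, ← map_sum]; exact (hDN _).trans hr') y hy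
    rw [hV]
    refine h.trans_eq ?_
    ring

theorem exists_weakStar_limit {α : Type*} (U : Ultrafilter α) (φ : α → Y →L[ℝ] ℝ) {K : ℝ}
    (hK : ∀ t, ‖φ t‖ ≤ K) : ∃ p : Y →L[ℝ] ℝ, ∀ y, Tendsto (fun t => φ t y) U (𝓝 (p y)) := by
  obtain ⟨p, -, hp⟩ := (WeakDual.isCompact_closedBall (𝕜 := ℝ) (E := Y) 0 K).ultrafilter_le_nhds
    (U.map fun t => StrongDual.toWeakDual (φ t))
    (by
      rw [le_principal_iff]
      refine Filter.mem_map.2 (univ_mem' fun t => ?_)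
      simpa using hK t)
  exact ⟨WeakDual.toStrongDual p, fun y => ((WeakDual.eval_continuous y).tendsto p).comp hp⟩

/-- A derivation that is majorized along a filter by uniformly bounded positive maps is regular. -/
theorem exists_positive_majorant {α : Type*} (l : Filter α) [l.NeBot]
    (D : arSubmodule X →ₗ[ℝ] (Y →L[ℝ] ℝ)) (V : α → (X →L[ℝ] X) →ₗ[ℝ] (Y →L[ℝ] ℝ)) {K : ℝ}
    (hV : ∀ t a, IsPosOp a → ∀ y, 0 ≤ y → 0 ≤ V t a y)
    (hVK : ∀ t a, IsPosOp a → ∀ y, 0 ≤ y → V t a y ≤ K * ‖a‖ * ‖y‖)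
    (δ : α → arSubmodule X → ℝ) (hδ : ∀ a, Tendsto (fun t => δ t a) l (𝓝 0))
    (hDV : ∀ t (a : arSubmodule X), IsPosOp a.1 → ∀ y, 0 ≤ y → D a y ≤ V t a y + δ t a * ‖y‖) :
    ∃ P : arSubmodule X →ₗ[ℝ] (Y →L[ℝ] ℝ), ∀ a : arSubmodule X, IsPosOp a.1 → ∀ y, 0 ≤ y →
      0 ≤ P a y ∧ D a y ≤ P a y := by
  have hbd : ∀ a ∈ LrSet X, ∃ K' : ℝ, ∀ t, ‖V t a‖ ≤ K' := fun a ha => by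
    rw [mem_LrSet_iff] at ha
    induction ha using Submodule.span_induction with
    | mem a ha =>
      refine ⟨|K * ‖a‖|, fun t => ContinuousLinearMap.opNorm_le_bound _ (abs_nonneg _) fun y => ?_⟩
      refine (BanachLattice.abs_map_le (V t a : Y →ₗ[ℝ] ℝ) (hV t a ha) y).trans ?_
      refine (hVK t a ha _ (abs_nonneg y)).trans ?_
      rw [norm_abs_eq_norm]
      exact mul_le_mul_of_nonneg_right (le_abs_self _) (norm_nonneg _)
    | zero => exact ⟨0, fun t => by simp⟩
    | add a b _ _ ha hb =>
      obtain ⟨Ka, ha⟩ := ha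
      obtain ⟨Kb, hb⟩ := hb
      exact ⟨Ka + Kb, fun t => by
        rw [map_add]
        exact (norm_add_le _ _).trans (add_le_add (ha t) (hb t))⟩
    | smul c a _ ha =>
      obtain ⟨Ka, ha⟩ := ha
      exact ⟨|c| * Ka, fun t => by
        rw [map_smul, norm_smul, Real.norm_eq_abs]
        exact mul_le_mul_of_nonneg_left (ha t) (abs_nonneg c)⟩
  have hlim : ∀ a : arSubmodule X, ∃ p : Y →L[ℝ] ℝ,
      ∀ y, Tendsto (fun t => V t a y) (Ultrafilter.of l) (𝓝 (p y)) := fun a => by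
    obtain ⟨K', hK'⟩ := hbd a.1 a.2.1
    exact exists_weakStar_limit _ _ hK'
  choose p hp using hlim
  refine ⟨{ toFun := p, map_add' := fun a b => ?_, map_smul' := fun c a => ?_ },
    fun a ha y hy => ⟨?_, ?_⟩⟩
  · ext y
    refine tendsto_nhds_unique (hp (a + b) y) ?_
    simpa using (hp a y).add (hp b y)
  · ext y
    refine tendsto_nhds_unique (hp (c • a) y) ?_
    simpa using (hp a y).const_mul c
  · exact ge_of_tendsto' (hp a y) fun t => hV t a ha y hy
  · have h := (hp a y).add (((hδ a).mono_left (Ultrafilter.of_le l)).mul_const ‖y‖)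
    rw [zero_mul, add_zero] at h
    exact ge_of_tendsto' h fun t => hDV t a ha y hy

theorem regularDerivOn_of_majorant {D : (X →L[ℝ] X) → (Y →L[ℝ] ℝ)}
    (D' P : arSubmodule X →ₗ[ℝ] (Y →L[ℝ] ℝ)) (hD : ∀ a : arSubmodule X, D' a = D a)
    (hP : ∀ a : arSubmodule X, IsPosOp a.1 → ∀ y, 0 ≤ y → 0 ≤ P a y ∧ D' a y ≤ P a y) :
    RegularDerivOn (ArSet X) D := by
  classical
  let ext0 : (arSubmodule X →ₗ[ℝ] (Y →L[ℝ] ℝ)) → (X →L[ℝ] X) → (Y →L[ℝ] ℝ) :=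
    fun Q a => if h : a ∈ arSubmodule X then Q ⟨a, h⟩ else 0
  have hext : ∀ Q a (h : a ∈ arSubmodule X), ext0 Q a = Q ⟨a, h⟩ := fun Q a h => dif_pos h
  have hadd : ∀ Q, ∀ a ∈ arSubmodule X, ∀ b ∈ arSubmodule X, ext0 Q (a + b) = ext0 Q a + ext0 Q b :=
    fun Q a ha b hb => by
      rw [hext Q a ha, hext Q b hb, hext Q _ ((arSubmodule X).add_mem ha hb), ← map_add]
      rfl
  have hsmul : ∀ Q, ∀ r : ℝ, ∀ a ∈ arSubmodule X, ext0 Q (r • a) = r • ext0 Q a :=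
    fun Q r a ha => by
      rw [hext Q a ha, hext Q _ ((arSubmodule X).smul_mem r ha), ← map_smul]
      rfl
  refine ⟨2, ![1, -1], ![ext0 P, ext0 (P - D')], fun t => ?_, fun a ha => ?_⟩
  · fin_cases t
    · refine ⟨hadd P, hsmul P, fun a ha hpos y hy => ?_⟩
      change (0 : ℝ) ≤ ext0 P a y
      rw [hext P a ha]
      exact (hP ⟨a, ha⟩ hpos y hy).1
    · refine ⟨hadd _, hsmul _, fun a ha hpos y hy => ?_⟩
      change (0 : ℝ) ≤ ext0 (P - D') a y
      rw [hext _ a ha]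
      exact sub_nonneg.2 (hP ⟨a, ha⟩ hpos y hy).2
  · have ha' : a ∈ arSubmodule X := ha
    rw [Fin.sum_univ_two]
    change D a = (1 : ℝ) • ext0 P a + (-1 : ℝ) • ext0 (P - D') a
    rw [hext _ a ha', hext _ a ha', LinearMap.sub_apply, hD]
    ext y
    change D a y = 1 * P ⟨a, ha'⟩ y + (-1) * (P ⟨a, ha'⟩ y - D a y)
    ring

theorem exists_linearMap_of_action {A : (X →L[ℝ] X) → Y → Y} {N : ℝ} (hN : 0 ≤ N)
    (hadd : ∀ a ∈ ArSet X, ∀ y₁ y₂ : Y, A a (y₁ + y₂) = A a y₁ + A a y₂)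
    (hlin : ∀ a ∈ ArSet X, ∀ b ∈ ArSet X, ∀ (s t : ℝ) (y : Y),
      A (s • a + t • b) y = s • A a y + t • A b y)
    (hbd : ∀ a ∈ ArSet X, ∀ y : Y, ‖A a y‖ ≤ N * rnorm a * ‖y‖) :
    ∃ L : arSubmodule X →ₗ[ℝ] (Y →L[ℝ] Y),
      (∀ a y, L a y = A a.1 y) ∧ ∀ a, ‖L a‖ ≤ N * rnorm a.1 := by
  let T : arSubmodule X → Y →L[ℝ] Y := fun a =>
    (AddMonoidHom.mk' (A a.1) (hadd a.1 a.2)).toRealLinearMap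
      (AddMonoidHomClass.continuous_of_bound _ _ (hbd a.1 a.2))
  have hT : ∀ a y, T a y = A a.1 y := fun a y => rfl
  refine ⟨{ toFun := T, map_add' := fun a b => ?_, map_smul' := fun c a => ?_ }, hT, fun a => ?_⟩
  · ext y
    simpa [hT] using hlin a.1 a.2 b.1 b.2 1 1 y
  · ext y
    simpa [hT] using hlin a.1 a.2 a.1 a.2 c 0 y
  · exact ContinuousLinearMap.opNorm_le_bound _ (mul_nonneg hN (rnorm_nonneg _))
      fun y => hbd a.1 a.2 y

end Derivation

theorem nonatomic_Ar_derivation_regular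
    {X 𝔛 : Type*} [NormedAddCommGroup X] [Lattice X] [HasSolidNorm X] [IsOrderedAddMonoid X] [NormedSpace ℝ X] [CompleteSpace X]
    [NormedAddCommGroup 𝔛] [Lattice 𝔛] [HasSolidNorm 𝔛] [IsOrderedAddMonoid 𝔛] [NormedSpace ℝ 𝔛] [CompleteSpace 𝔛]
    (μ : ℝ) (hμ : 1 ≤ μ)
    -- Π is a directed bounded generating system for X:
    (Pgen : Set (X →L[ℝ] X))
    (hPgpos : ∀ σ ∈ Pgen, IsPosOp σ)
    (hPgproj : ∀ σ ∈ Pgen, σ ∘L σ = σ)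
    (hPgbdd : ∃ C : ℝ, ∀ σ ∈ Pgen, ‖σ‖ ≤ C)
    (hPgriesz : ∀ σ ∈ Pgen, ∀ y ∈ Set.range ⇑σ, ∀ z ∈ Set.range ⇑σ, y ⊔ z ∈ Set.range ⇑σ)
    (hPgdense : ∀ (ξ : X) (ε : ℝ), 0 < ε → ∃ σ ∈ Pgen, ∃ y ∈ Set.range ⇑σ, ‖ξ - y‖ < ε)
    (hPgdir : ∀ σ₁ ∈ Pgen, ∀ σ₂ ∈ Pgen, ∃ σ₃ ∈ Pgen,
      Set.range ⇑σ₁ ⊆ Set.range ⇑σ₃ ∧ Set.range ⇑σ₂ ⊆ Set.range ⇑σ₃)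
    -- for each σ ∈ Π, (xb σ i) is a shrinking basis for σ(X) satisfying (⋆) with
    -- constant μ in each summand, with biorthogonal functionals (xsb σ i); the
    -- natural projections ι_σ e_n^{(σ)} p_σ ∈ ℒʳ(X) are eproj (xb σ) (xsb σ) n:
    (xb : (X →L[ℝ] X) → ℕ → X) (xsb : (X →L[ℝ] X) → ℕ → (X →L[ℝ] ℝ))
    (hxbmem : ∀ σ ∈ Pgen, ∀ i, xb σ i ∈ Set.range ⇑σ)
    (hxsbfac : ∀ σ ∈ Pgen, ∀ i, (xsb σ i).comp σ = xsb σ i)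
    (hstarσ : ∀ σ ∈ Pgen, StarSummandBasisOn (Set.range ⇑σ) μ (xb σ))
    (hbiσ : ∀ σ ∈ Pgen, ∀ i j, xsb σ i (xb σ j) = if i = j then (1 : ℝ) else 0)
    (hbasisσ : ∀ σ ∈ Pgen, ∀ y ∈ Set.range ⇑σ,
      Tendsto (fun n => eproj (xb σ) (xsb σ) n y) atTop (𝓝 y))
    (hshrinkσ : ∀ σ ∈ Pgen, ∀ l : X →L[ℝ] ℝ,
      Tendsto (fun n => sSup {r : ℝ | ∃ y ∈ Set.range ⇑σ, ‖y‖ ≤ 1 ∧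
        r = |l y - l (eproj (xb σ) (xsb σ) n y)|}) atTop (𝓝 0))
    -- lim_σ ‖λ − λ∘σ‖ = 0 for every λ ∈ X′:
    (hdualconv : ∀ l : X →L[ℝ] ℝ,
      Tendsto (fun σ : {σ : X →L[ℝ] X // σ ∈ Pgen} => ‖l - l.comp σ.val‖)
        (piFilter Pgen) (𝓝 0))
    -- 𝔛 is a Banach lattice 𝒜ʳ(X)-module, with actions Ml, Mr and constant M:
    (Ml Mr : (X →L[ℝ] X) → 𝔛 → 𝔛) (M : ℝ)
    (hMladd : ∀ a ∈ ArSet X, ∀ y₁ y₂ : 𝔛, Ml a (y₁ + y₂) = Ml a y₁ + Ml a y₂)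
    (hMradd : ∀ a ∈ ArSet X, ∀ y₁ y₂ : 𝔛, Mr a (y₁ + y₂) = Mr a y₁ + Mr a y₂)
    (hMllin : ∀ a ∈ ArSet X, ∀ b ∈ ArSet X, ∀ (s t : ℝ) (y : 𝔛),
      Ml (s • a + t • b) y = s • Ml a y + t • Ml b y)
    (hMrlin : ∀ a ∈ ArSet X, ∀ b ∈ ArSet X, ∀ (s t : ℝ) (y : 𝔛),
      Mr (s • a + t • b) y = s • Mr a y + t • Mr b y)
    (hMlmul : ∀ a ∈ ArSet X, ∀ b ∈ ArSet X, ∀ y : 𝔛, Ml (a ∘L b) y = Ml a (Ml b y))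
    (hMrmul : ∀ a ∈ ArSet X, ∀ b ∈ ArSet X, ∀ y : 𝔛, Mr (a ∘L b) y = Mr b (Mr a y))
    (hMlr : ∀ a ∈ ArSet X, ∀ b ∈ ArSet X, ∀ y : 𝔛, Ml a (Mr b y) = Mr b (Ml a y))
    (hMpos : ∀ a ∈ ArSet X, IsPosOp a → ∀ y : 𝔛, 0 ≤ y → 0 ≤ Ml a y ∧ 0 ≤ Mr a y)
    (hMbd : ∀ a ∈ ArSet X, ∀ y : 𝔛,
      ‖Ml a y‖ ≤ M * rnorm a * ‖y‖ ∧ ‖Mr a y‖ ≤ M * rnorm a * ‖y‖)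
    -- dual module products on 𝔛′ := 𝔛 →L[ℝ] ℝ :
    (DL DR : (X →L[ℝ] X) → (𝔛 →L[ℝ] ℝ) → (𝔛 →L[ℝ] ℝ))
    (hDL : ∀ a ∈ ArSet X, ∀ (x' : 𝔛 →L[ℝ] ℝ) (y : 𝔛), DL a x' y = x' (Mr a y))
    (hDR : ∀ a ∈ ArSet X, ∀ (x' : 𝔛 →L[ℝ] ℝ) (y : 𝔛), DR a x' y = x' (Ml a y))
    -- the sequences (e_n^{(σ)}·x) and (x·e_n^{(σ)}) converge in norm for every
    -- x ∈ 𝔛 and σ ∈ Π: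
    (hconv : ∀ σ ∈ Pgen, ∀ y : 𝔛,
      (∃ ly : 𝔛, Tendsto (fun n => Ml (eproj (xb σ) (xsb σ) n) y) atTop (𝓝 ly)) ∧
      (∃ ly : 𝔛, Tendsto (fun n => Mr (eproj (xb σ) (xsb σ) n) y) atTop (𝓝 ly)))
    -- (i) or (ii):
    (hcases :
      -- (i): X contains no copy of ℓ₁ and 𝔛 contains no complemented copy of ℓ₁:
      (¬ HasL1Copy X ∧ ¬ HasComplementedL1 𝔛) ∨
      -- (ii): X is reflexive and dim(e_n^{(σ)}·𝔛′·e_n^{(σ)}) < ∞ :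
      (Function.Surjective (NormedSpace.inclusionInDoubleDual ℝ X) ∧
        ∀ σ ∈ Pgen, ∀ n : ℕ, ∃ (m : ℕ) (b : Fin m → (𝔛 →L[ℝ] ℝ)),
          ∀ ξ : 𝔛 →L[ℝ] ℝ,
            (∃ x' : 𝔛 →L[ℝ] ℝ,
              ξ = DL (eproj (xb σ) (xsb σ) n) (DR (eproj (xb σ) (xsb σ) n) x')) →
            ∃ c : Fin m → ℝ, ξ = ∑ t, c t • b t))
    -- D is a bounded derivation from 𝒜ʳ(X) to 𝔛′:
    (D : (X →L[ℝ] X) → (𝔛 →L[ℝ] ℝ))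
    (hDadd : ∀ a ∈ ArSet X, ∀ b ∈ ArSet X, D (a + b) = D a + D b)
    (hDsmul : ∀ (r : ℝ), ∀ a ∈ ArSet X, D (r • a) = r • D a)
    (hDder : ∀ a ∈ ArSet X, ∀ b ∈ ArSet X, D (a ∘L b) = DL a (D b) + DR b (D a))
    (hDbdd : ∃ C : ℝ, ∀ a ∈ ArSet X, ‖D a‖ ≤ C * rnorm a) :
    RegularDerivOn (ArSet X) D := by
  obtain ⟨C, hC⟩ := hPgbdd
  obtain ⟨CD, hCD⟩ := hDbdd
  have hne : Pgen.Nonempty := by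
    obtain ⟨σ, hσ, -⟩ := hPgdense 0 1 one_pos
    exact ⟨σ, hσ⟩
  have hC0 : 0 ≤ C := by
    obtain ⟨σ, hσ⟩ := hne
    exact (norm_nonneg σ).trans (hC σ hσ)
  set N : ℝ := |M| + |CD| with hNdef
  have hN : 0 ≤ N := by positivity
  have hMN : M ≤ N := (le_abs_self M).trans (le_add_of_nonneg_right (abs_nonneg _))
  have hCDN : CD ≤ N := (le_abs_self CD).trans (le_add_of_nonneg_left (abs_nonneg _))
  have hmul : ∀ (a : X →L[ℝ] X) (y : 𝔛), M * rnorm a * ‖y‖ ≤ N * rnorm a * ‖y‖ := fun a y =>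
    mul_le_mul_of_nonneg_right (mul_le_mul_of_nonneg_right hMN (rnorm_nonneg a)) (norm_nonneg y)
  obtain ⟨L, hL, hLN⟩ := exists_linearMap_of_action hN hMladd hMllin
    fun a ha y => (hMbd a ha y).1.trans (hmul a y)
  obtain ⟨R, hR, hRN⟩ := exists_linearMap_of_action hN hMradd hMrlin
    fun a ha y => (hMbd a ha y).2.trans (hmul a y)
  let D' : arSubmodule X →ₗ[ℝ] (𝔛 →L[ℝ] ℝ) :=
    { toFun := fun a => D a.1
      map_add' := fun a b => hDadd a.1 a.2 b.1 b.2
      map_smul' := fun c a => hDsmul c a.1 a.2 }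
  have hD' : ∀ a : arSubmodule X, D' a = D a.1 := fun a => rfl
  have hDN : ∀ a, ‖D' a‖ ≤ N * rnorm a.1 := fun a =>
    (hCD a.1 a.2).trans (mul_le_mul_of_nonneg_right hCDN (rnorm_nonneg _))
  have hatom : ∀ σ ∈ Pgen, ∀ i, IsNormAtomOn (Set.range ⇑σ) (xb σ i) := fun σ hσ => by
    obtain ⟨I, ψ, -, -, -, h, -⟩ := hstarσ σ hσ
    exact h
  have hxb : ∀ σ ∈ Pgen, ∀ i, 0 ≤ xb σ i := fun σ hσ i => (hatom σ hσ i).2.1.le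
  have hxsb : ∀ σ ∈ Pgen, ∀ i y, 0 ≤ y → 0 ≤ xsb σ i y := fun σ hσ i y hy => by
    rw [← hxsbfac σ hσ i]
    exact coord_nonneg (hPgriesz σ hσ) (hatom σ hσ) (hbiσ σ hσ) (hbasisσ σ hσ) ⟨y, rfl⟩
      (hPgpos σ hσ y hy) i
  have hepos : ∀ σ ∈ Pgen, ∀ n, IsPosOp (eproj (xb σ) (xsb σ) n) := fun σ hσ n y hy => by
    simp only [eproj, FunLike.coe_sum, Finset.sum_apply, ContinuousLinearMap.smulRight_apply]
    exact Finset.sum_nonneg fun i _ => smul_nonneg (hxsb σ hσ i y hy) (hxb σ hσ i)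
  have heC : ∀ σ ∈ Pgen, ∀ n, ‖eproj (xb σ) (xsb σ) n‖ ≤ C := fun σ hσ n => by
    refine (norm_le_of_dominated fun y => ?_).trans (hC σ hσ)
    exact (abs_apply_le_of_isPosOp (hepos σ hσ n) y).trans
      (eproj_le (hxsbfac σ hσ) (hbasisσ σ hσ) (hxb σ hσ) (hxsb σ hσ) n (abs_nonneg y))
  choose V hV0 hVD hVK using fun t : {σ : X →L[ℝ] X // σ ∈ Pgen} × ℕ =>
    exists_compression_majorant L R D' hN hC0
      (fun a b c h y => by rw [hL, hL, hL, h]; exact hMlmul a.1 a.2 b.1 b.2 y)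
      (fun a b c h y => by rw [hR, hR, hR, h]; exact hMrmul a.1 a.2 b.1 b.2 y)
      (fun a b y => by rw [hL, hR, hR, hL]; exact hMlr a.1 a.2 b.1 b.2 y)
      (fun a b c h y => by
        rw [hD', hD', hD', h, hDder a.1 a.2 b.1 b.2, add_apply, hDL a.1 a.2, hDR b.1 b.2, hR, hL])
      (fun a ha y hy => by rw [hL]; exact (hMpos a.1 a.2 ha y hy).1)
      (fun a ha y hy => by rw [hR]; exact (hMpos a.1 a.2 ha y hy).2)
      hLN hRN hDN (xb t.1) (xsb t.1) (hxb t.1 t.1.2) (hxsb t.1 t.1.2) (hbiσ t.1 t.1.2) t.2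
      (heC t.1 t.1.2 t.2)
  have := piFilter_neBot hne hPgdir
  have : ((piFilter Pgen).curry (atTop : Filter ℕ)).NeBot := curry_neBot
  have hconv' : ∀ a : arSubmodule X, Tendsto (fun t : {σ : X →L[ℝ] X // σ ∈ Pgen} × ℕ =>
      N * rnorm (a.1 - eproj (xb t.1) (xsb t.1) t.2 ∘L a.1 ∘L eproj (xb t.1) (xsb t.1) t.2))
      ((piFilter Pgen).curry atTop) (𝓝 0) := fun a => by
    have hv := tendsto_norm_sub_apply_curry (e := fun σ n => eproj (xb σ) (xsb σ) n) hC0 hPgdense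
      heC hbasisσ
    have hf := tendsto_norm_sub_comp_curry (e := fun σ n => eproj (xb σ) (xsb σ) n) hC0 hC
      (fun σ hσ n y => eproj_comp (xb σ) (hxsbfac σ hσ) n y) hshrinkσ hdualconv
    have h := tendsto_rnorm_sub_comp
      (e := fun t : {σ : X →L[ℝ] X // σ ∈ Pgen} × ℕ => eproj (xb t.1) (xsb t.1) t.2)
      (fun t => hepos t.1 t.1.2 t.2) (fun t => heC t.1 t.1.2 t.2) hv hf a.2
    simpa using h.const_mul N
  obtain ⟨P, hP⟩ := exists_positive_majorant _ D' V hV0 hVK _ hconv' hVD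
  exact regularDerivOn_of_majorant D' P hD' hP
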